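/- arXiv:1203.5352 — 6 statements merged into one kernel-verified Lean document; each statement's English description precedes it below -/
import Mathlib

section
/- Let k be a field of characteristic p > 2 and let q be a nondegenerate ternary quadratic form over k with Gram matrix Q. If the group SO(q)(k) = {M ∈ M₃(k) : Mᵀ Q M = Q, det M = 1} contains an element M of multiplicative order p, then q is isotropic, i.e., there exists a nonzero vector v ∈ k³ with vᵀ Q v = 0. -/
open Matrix

/-- If `M` preserves the bilinear form with Gram matrix `Q`, then every fixed vector of `M` lying in
the image of `M - 1` is isotropic. -/
lemma Matrix.dotProduct_mulVec_self_eq_zero_of_fixed {n R : Type*} [Fintype n] [DecidableEq n]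
    [CommRing R] {Q M : Matrix n n R} (hMQ : Mᵀ * Q * M = Q) {w z : n → R}
    (hw : M *ᵥ w = w) (hz : (M - 1) *ᵥ z = w) : w ⬝ᵥ Q *ᵥ w = 0 := by
  have h : w ⬝ᵥ Q *ᵥ (M *ᵥ z) = w ⬝ᵥ Q *ᵥ z := by
    conv_rhs => rw [← hMQ, ← mulVec_mulVec, ← mulVec_mulVec, dotProduct_mulVec w Mᵀ,
      vecMul_transpose, hw]
  conv_lhs => rw [← hz, sub_mulVec, one_mulVec, mulVec_sub, dotProduct_sub]
  rw [sub_mulVec, one_mulVec] at hz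
  rw [hz, h, sub_self]

/-- A form preserved by a nontrivial unipotent matrix is isotropic. -/
lemma Matrix.exists_isotropic_of_isNilpotent_sub_one {n R : Type*} [Fintype n] [DecidableEq n]
    [CommRing R] {Q M : Matrix n n R} (hMQ : Mᵀ * Q * M = Q) (hM : M ≠ 1)
    (hnil : IsNilpotent (M - 1)) : ∃ v : n → R, v ≠ 0 ∧ v ⬝ᵥ Q *ᵥ v = 0 := by
  classical
  obtain ⟨m, hm, hm'⟩ : ∃ m, (M - 1) ^ (m + 1) ≠ 0 ∧ (M - 1) ^ (m + 2) = 0 := by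
    by_contra! h
    obtain ⟨r, hr⟩ := hnil
    have key : ∀ m, (M - 1) ^ (m + 1) ≠ 0 := fun m => by
      induction m with
      | zero => simpa [sub_eq_zero] using hM
      | succ m ih => exact h m ih
    exact key r (by rw [pow_succ, hr, zero_mul])
  obtain ⟨u, hu⟩ : ∃ u, (M - 1) ^ (m + 1) *ᵥ u ≠ 0 := by
    by_contra! h
    exact hm (Matrix.ext_of_mulVec_single fun i => by rw [h, zero_mulVec])
  refine ⟨_, hu, dotProduct_mulVec_self_eq_zero_of_fixed hMQ (z := (M - 1) ^ m *ᵥ u) ?_ ?_⟩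
  · have h : (M - 1) *ᵥ (M - 1) ^ (m + 1) *ᵥ u = 0 := by
      rw [mulVec_mulVec, ← pow_succ', hm', zero_mulVec]
    rwa [sub_mulVec M, one_mulVec, sub_eq_zero] at h
  · rw [mulVec_mulVec, ← pow_succ']

/-- If `k` has characteristic `p > 2` and `SO(q)(k)` contains an element of multiplicative
order `p`, then the nondegenerate ternary quadratic form `q` is isotropic. -/
theorem so3_p_irregular_implies_isotropic
    (k : Type) [Field k] (p : ℕ) (hchar : ringChar k = p) (hp : 2 < p)
    (Q : Matrix (Fin 3) (Fin 3) k) (hsymm : Qᵀ = Q) (hnondeg : IsUnit Q.det)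
    (M : Matrix (Fin 3) (Fin 3) k)
    (hMQ : Mᵀ * Q * M = Q) (hMdet : M.det = 1) (hord : orderOf M = p) :
    ∃ v : Fin 3 → k, v ≠ 0 ∧ v ⬝ᵥ Q.mulVec v = 0 := by
  have : CharP k p := ringChar.of_eq hchar
  have : Fact p.Prime := ⟨(CharP.char_is_prime_or_zero k p).resolve_right (by lia)⟩
  refine exists_isotropic_of_isNilpotent_sub_one hMQ ?_ ⟨p, ?_⟩
  · rintro rfl
    rw [orderOf_one] at hord
    lia
  · rw [sub_pow_char_of_commute p (Commute.one_right M), ← hord, pow_orderOf_eq_one, one_pow,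
      sub_self]
end

section
/- Let k be a field with char(k) ≠ 2, let n ≥ 3 with char(k) not dividing n, and let q be a nondegenerate ternary quadratic form over k whose Gram matrix Q has determinant a nonzero square (discriminant 1). If SO(q)(k) contains an element of multiplicative order n, then there exists a primitive n-th root of unity ω in an algebraic closure k̄ of k and an element α ∈ k whose image in k̄ equals (ω + ω⁻¹)/2, and q represents −β where β = α² − 1, i.e., vᵀ Q v = −β for some v ∈ k³. -/
open Matrix

theorem eval_charpoly_fin_three {R : Type*} [CommRing R] (M : Matrix (Fin 3) (Fin 3) R) (x : R) :
    M.charpoly.eval x = x ^ 3 - M.trace * x ^ 2 + M.adjugate.trace * x - M.det := by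
  rw [Matrix.eval_charpoly]
  simp [det_fin_three, trace_fin_three, adjugate_fin_three, Matrix.scalar_apply]
  ring

theorem trace_adjugate_sub_fin_three {R : Type*} [CommRing R] (M N : Matrix (Fin 3) (Fin 3) R) :
    (M - N).adjugate.trace =
      M.adjugate.trace + N.adjugate.trace - M.trace * N.trace + (M * N).trace := by
  simp [trace_fin_three, adjugate_fin_three, Matrix.mul_apply, Fin.sum_univ_three]
  ring

/-- The vector `w` such that the alternating matrix `A` acts as the cross product with `w`. -/
def axialVector {R : Type*} (A : Matrix (Fin 3) (Fin 3) R) : Fin 3 → R := ![A 2 1, A 0 2, A 1 0]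

theorem axialVector_dotProduct_mulVec {R : Type*} [CommRing R] (A Q : Matrix (Fin 3) (Fin 3) R)
    (hA : Aᵀ = -A) (hA0 : ∀ i, A i i = 0) :
    axialVector A ⬝ᵥ Q *ᵥ axialVector A = (Q * A.adjugate).trace := by
  have h (i j) : A j i = - A i j := congrFun₂ hA i j
  simp [trace_fin_three, adjugate_fin_three, Matrix.mul_apply, Fin.sum_univ_three, axialVector,
    dotProduct, mulVec, hA0, h 0 1, h 0 2, h 1 2]
  ring

section Isometry

variable {R : Type*} [CommRing R] {Q M : Matrix (Fin 3) (Fin 3) R}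

theorem transpose_mul_eq_mul_adjugate_of_isometry (hMQ : Mᵀ * Q * M = Q) (hM : M.det = 1) :
    Mᵀ * Q = Q * M.adjugate := by
  calc Mᵀ * Q = Mᵀ * Q * (M * M.adjugate) := by rw [mul_adjugate, hM, one_smul, mul_one]
    _ = Q * M.adjugate := by rw [← mul_assoc, hMQ]

theorem trace_adjugate_of_isometry (hQ : IsUnit Q.det) (hMQ : Mᵀ * Q * M = Q) (hM : M.det = 1) :
    M.adjugate.trace = M.trace := by
  calc M.adjugate.trace = (Q⁻¹ * (Q * M.adjugate)).trace := by
        rw [← mul_assoc, nonsing_inv_mul _ hQ, one_mul]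
    _ = (Mᵀ * (Q * Q⁻¹)).trace := by
        rw [← transpose_mul_eq_mul_adjugate_of_isometry hMQ hM, trace_mul_comm, mul_assoc]
    _ = M.trace := by rw [mul_nonsing_inv _ hQ, mul_one, trace_transpose]

theorem axialVector_isometry (hsymm : Qᵀ = Q) (hQ : IsUnit Q.det) (hMQ : Mᵀ * Q * M = Q)
    (hM : M.det = 1) :
    axialVector (Q * M - Mᵀ * Q) ⬝ᵥ Q *ᵥ axialVector (Q * M - Mᵀ * Q) =
      Q.det * ((3 - M.trace) * (1 + M.trace)) := by
  have hT : (Q * M)ᵀ = Mᵀ * Q := by rw [transpose_mul, hsymm]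
  rw [axialVector_dotProduct_mulVec]
  · rw [transpose_mul_eq_mul_adjugate_of_isometry hMQ hM, ← mul_sub, adjugate_mul_distrib,
      trace_mul_comm, mul_assoc, adjugate_mul, mul_smul_comm, mul_one, trace_smul, smul_eq_mul,
      trace_adjugate_sub_fin_three, trace_adjugate_of_isometry hQ hMQ hM, mul_adjugate, hM,
      adjugate_adjugate _ (by simp), hM]
    simp
    ring
  · rw [← hT, transpose_sub, transpose_transpose, neg_sub]
  · intro i
    rw [← hT, Matrix.sub_apply, transpose_apply, sub_self]

end Isometry

theorem isPrimitiveRoot_of_isRoot_charpoly {k K : Type*} [Field k] [Field K] [IsAlgClosed K]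
    [Algebra k K] {ι : Type*} [Fintype ι] [DecidableEq ι] {M : Matrix ι ι k} {ω : K}
    (hn : (orderOf M : k) ≠ 0)
    (hroot : ((M.map (algebraMap k K)).charpoly).IsRoot ω)
    (hroots : ∀ x : K, ((M.map (algebraMap k K)).charpoly).IsRoot x →
      ∀ m : ℕ, ω ^ m = 1 → x ^ m = 1) :
    IsPrimitiveRoot ω (orderOf M) := by
  constructor
  · have h := spectrum.pow_mem_pow (M.map (algebraMap k K)) (orderOf M)
      (mem_spectrum_iff_isRoot_charpoly.2 hroot)
    have : Nontrivial (Matrix ι ι K) := by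
      by_contra hh
      rw [not_nontrivial_iff_subsingleton] at hh
      simp [spectrum.of_subsingleton] at h
    have h1 : M.map (algebraMap k K) ^ orderOf M = 1 := by
      rw [← Matrix.map_pow, pow_orderOf_eq_one]
      simp
    rw [h1, spectrum.one_eq] at h
    simpa using h
  · intro m hm
    apply orderOf_dvd_of_pow_eq_one
    rcases Nat.eq_zero_or_pos m with rfl | hmpos
    · simp
    have hdvd : minpoly k M ∣ Polynomial.X ^ orderOf M - 1 :=
      minpoly.dvd _ _ (by simp [pow_orderOf_eq_one])
    have hsep : (minpoly k M).Separable :=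
      (Polynomial.X_pow_sub_one_separable_iff.2 hn).of_dvd hdvd
    have hne : (Polynomial.X ^ m - 1 : Polynomial K) ≠ 0 :=
      (Polynomial.monic_X_pow_sub_C 1 hmpos.ne').ne_zero
    have hf : (minpoly k M).map (algebraMap k K) ∣ Polynomial.X ^ m - 1 := by
      refine (IsAlgClosed.splits _).dvd_of_roots_le_roots ?_ ?_
      · exact (hsep.map).ne_zero
      · rw [Multiset.le_iff_subset (Polynomial.nodup_roots hsep.map)]
        intro x hx
        have hx' := (Polynomial.isRoot_of_mem_roots hx).dvd
          (Polynomial.map_dvd (algebraMap k K) M.minpoly_dvd_charpoly)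
        rw [charpoly_map] at hroots
        rw [Polynomial.mem_roots hne]
        simp [hroots x hx' m hm]
    have hf' : minpoly k M ∣ Polynomial.X ^ m - 1 := by
      rw [← Polynomial.map_dvd_map' (algebraMap k K)]
      simpa using hf
    have := (minpoly.dvd_iff).1 hf'
    simpa [sub_eq_zero] using this

theorem so3_order_n_implies_alpha_and_represents
    (k : Type) [Field k] (hchar : ringChar k ≠ 2)
    (n : ℕ) (hn : 3 ≤ n) (hcharn : ¬ (ringChar k ∣ n))
    (Q : Matrix (Fin 3) (Fin 3) k) (hsymm : Qᵀ = Q)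
    (hdisc : ∃ d : k, d ≠ 0 ∧ Q.det = d ^ 2)
    (M : Matrix (Fin 3) (Fin 3) k)
    (hMQ : Mᵀ * Q * M = Q) (hMdet : M.det = 1) (hord : orderOf M = n) :
    ∃ ω : AlgebraicClosure k, IsPrimitiveRoot ω n ∧
      ∃ α : k, algebraMap k (AlgebraicClosure k) α = (ω + ω⁻¹) / 2 ∧
        ∃ v : Fin 3 → k, v ⬝ᵥ Q.mulVec v = -(α ^ 2 - 1) := by
  obtain ⟨d, hd, hQd⟩ := hdisc
  have h2 : (2 : k) ≠ 0 := Ring.two_ne_zero hchar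
  have hQ : IsUnit Q.det := by rw [hQd]; exact (pow_ne_zero 2 hd).isUnit
  have h2' : (2 : AlgebraicClosure k) ≠ 0 := by
    rw [← map_ofNat (algebraMap k (AlgebraicClosure k)) 2]
    exact (map_ne_zero _).2 h2
  have : NeZero (2 : AlgebraicClosure k) := ⟨h2'⟩
  set t : AlgebraicClosure k := algebraMap k _ M.trace with ht
  have heval (x : AlgebraicClosure k) :
      (M.map (algebraMap k (AlgebraicClosure k))).charpoly.eval x =
        (x - 1) * (x * x + (1 - t) * x + 1) := by
    rw [eval_charpoly_fin_three, ← RingHom.mapMatrix_apply, ← RingHom.map_adjugate,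
      ← RingHom.map_det, RingHom.mapMatrix_apply, RingHom.mapMatrix_apply,
      ← AddMonoidHom.map_trace, ← AddMonoidHom.map_trace,
      trace_adjugate_of_isometry hQ hMQ hMdet, hMdet, map_one, ← ht]
    ring
  obtain ⟨ω, hω⟩ := exists_quadratic_eq_zero (a := (1 : AlgebraicClosure k)) (b := 1 - t) (c := 1)
    one_ne_zero (IsAlgClosed.exists_eq_mul_self _)
  rw [one_mul] at hω
  have hω0 : ω ≠ 0 := by
    rintro rfl
    simp at hω
  have hsum : ω + ω⁻¹ = t - 1 := by
    field_simp
    linear_combination hω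
  refine ⟨ω, ?_, (M.trace - 1) / 2, ?_, (2 * d)⁻¹ • axialVector (Q * M - Mᵀ * Q), ?_⟩
  · rw [← hord]
    apply isPrimitiveRoot_of_isRoot_charpoly
    · rw [hord]
      exact fun h => hcharn (ringChar.dvd h)
    · rw [Polynomial.IsRoot, heval, hω, mul_zero]
    · intro x hx m hm
      rw [Polynomial.IsRoot, heval] at hx
      have hx' : (x - 1) * ((x - ω) * (x - ω⁻¹)) = 0 := by
        rw [← hx]
        have : ω * ω⁻¹ = 1 := mul_inv_cancel₀ hω0
        linear_combination (x - 1) * (this - x * hsum)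
      rcases mul_eq_zero.1 hx' with h | h
      · rw [sub_eq_zero.1 h, one_pow]
      rcases mul_eq_zero.1 h with h | h
      · rw [sub_eq_zero.1 h, hm]
      · rw [sub_eq_zero.1 h, inv_pow, hm, inv_one]
  · rw [hsum, map_div₀, map_sub, map_one, map_ofNat]
  · rw [mulVec_smul, dotProduct_smul, smul_dotProduct, axialVector_isometry hsymm hQ hMQ hMdet,
      hQd, smul_eq_mul, smul_eq_mul]
    field_simp
    ring
end

section
/- Let k be a field with char(k) ≠ 2 and n ≥ 3. Suppose there exist a primitive n-th root of unity ω in an algebraic closure k̄ of k and an element α ∈ k whose image in k̄ equals (ω + ω⁻¹)/2; set β = α² − 1. If a nondegenerate ternary quadratic form q over k of discriminant 1 represents −β, then SO(q)(k) contains a subgroup isomorphic to the dihedral group of order 2n (and in particular an element of order n). Explicitly, for q = ⟨−β,−γ,βγ⟩ (γ ∈ k^×), the matrices s = [[1,0,0],[0,α,β],[0,1,α]] and t = diag(−1,1,−1) lie in SO(q)(k) and satisfy sⁿ = t² = (st)² = 1, generating a dihedral group of order 2n. -/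
open Matrix

/-- The special orthogonal group `SO(q)(k)` of a ternary quadratic form with Gram matrix `Q`,
realized as the subgroup of `GL (Fin 3) k` consisting of the matrices `M` with
`Mᵀ * Q * M = Q` and `det M = 1`. -/
def SO3 (k : Type) [Field k] (Q : Matrix (Fin 3) (Fin 3) k) :
    Subgroup (GL (Fin 3) k) where
  carrier := {M | (M : Matrix (Fin 3) (Fin 3) k)ᵀ * Q * (M : Matrix (Fin 3) (Fin 3) k) = Q ∧
      (M : Matrix (Fin 3) (Fin 3) k).det = 1}
  one_mem' := by
    constructor
    · simp
    · simp
  mul_mem' := by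
    rintro A B ⟨hA, hA'⟩ ⟨hB, hB'⟩
    constructor
    · have hAB : ((A * B : GL (Fin 3) k) : Matrix (Fin 3) (Fin 3) k)
        = (A : Matrix (Fin 3) (Fin 3) k) * (B : Matrix (Fin 3) (Fin 3) k) := rfl
      rw [hAB, transpose_mul]
      calc (B : Matrix (Fin 3) (Fin 3) k)ᵀ * (A : Matrix (Fin 3) (Fin 3) k)ᵀ * Q *
            ((A : Matrix (Fin 3) (Fin 3) k) * (B : Matrix (Fin 3) (Fin 3) k))
          = (B : Matrix (Fin 3) (Fin 3) k)ᵀ *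
            ((A : Matrix (Fin 3) (Fin 3) k)ᵀ * Q * (A : Matrix (Fin 3) (Fin 3) k)) *
            (B : Matrix (Fin 3) (Fin 3) k) := by noncomm_ring
        _ = Q := by rw [hA, hB]
    · have hAB : ((A * B : GL (Fin 3) k) : Matrix (Fin 3) (Fin 3) k)
        = (A : Matrix (Fin 3) (Fin 3) k) * (B : Matrix (Fin 3) (Fin 3) k) := rfl
      rw [hAB, det_mul, hA', hB', one_mul]
  inv_mem' := by
    rintro A ⟨hA, hA'⟩
    have hinv : ((A⁻¹ : GL (Fin 3) k) : Matrix (Fin 3) (Fin 3) k)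
        = (A : Matrix (Fin 3) (Fin 3) k)⁻¹ := by
      simp [Matrix.coe_units_inv]
    have h1 : (A : Matrix (Fin 3) (Fin 3) k) * ((A⁻¹ : GL (Fin 3) k) : Matrix (Fin 3) (Fin 3) k)
        = 1 := by
      rw [hinv]
      exact Matrix.mul_nonsing_inv _ (by rw [hA']; exact isUnit_one)
    constructor
    · calc ((A⁻¹ : GL (Fin 3) k) : Matrix (Fin 3) (Fin 3) k)ᵀ * Q *
            ((A⁻¹ : GL (Fin 3) k) : Matrix (Fin 3) (Fin 3) k)
          = ((A⁻¹ : GL (Fin 3) k) : Matrix (Fin 3) (Fin 3) k)ᵀ *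
            ((A : Matrix (Fin 3) (Fin 3) k)ᵀ * Q * (A : Matrix (Fin 3) (Fin 3) k)) *
            ((A⁻¹ : GL (Fin 3) k) : Matrix (Fin 3) (Fin 3) k) := by rw [hA]
        _ = ((A : Matrix (Fin 3) (Fin 3) k) *
              ((A⁻¹ : GL (Fin 3) k) : Matrix (Fin 3) (Fin 3) k))ᵀ * Q *
            ((A : Matrix (Fin 3) (Fin 3) k) *
              ((A⁻¹ : GL (Fin 3) k) : Matrix (Fin 3) (Fin 3) k)) := by
            rw [transpose_mul]; noncomm_ring
        _ = Q := by rw [h1]; simp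
    · rw [hinv, Matrix.det_nonsing_inv, hA']; simp

/-- Two elements `S`, `T` of a group with `S` of order `n ≥ 3` and `T² = (ST)² = 1` generate a
dihedral group of order `2n`. -/
theorem closure_pair_mulEquiv_dihedralGroup {G : Type*} [Group G] {S T : G} {n : ℕ}
    (hn : 3 ≤ n) (hS : orderOf S = n) (hT : T * T = 1) (hST : S * T * (S * T) = 1) :
    Nonempty (Subgroup.closure {S, T} ≃* DihedralGroup n) := by
  have key (a b : ℤ) : S ^ a = S ^ b ↔ (a : ZMod n) = b := by
    rw [zpow_eq_zpow_iff_modEq, hS, ZMod.intCast_eq_intCast_iff]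
  have hTi : T⁻¹ = T := inv_eq_of_mul_eq_one_left hT
  have hconj : T * S * T⁻¹ = S⁻¹ := by
    rw [hTi]
    exact eq_inv_of_mul_eq_one_right (by simpa [mul_assoc] using hST)
  have hcomm (a : ℤ) : S ^ a * T = T * S ^ (-a) := by
    have h : T * S ^ (-a) * T⁻¹ = S ^ a := by
      rw [← conj_zpow, hconj, _root_.inv_zpow', neg_neg]
    rw [← h, inv_mul_cancel_right]
  let f : DihedralGroup n →* G := MonoidHom.mk'
    (fun x => match x with
      | .r i => S ^ (i.cast : ℤ)
      | .sr i => T * S ^ (i.cast : ℤ)) (by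
    rintro (i | i) (j | j)
    · simp only [DihedralGroup.r_mul_r]
      rw [← _root_.zpow_add, key]
      simp
    · simp only [DihedralGroup.r_mul_sr]
      rw [← mul_assoc, hcomm, mul_assoc, ← _root_.zpow_add, mul_right_inj, key]
      simp [sub_eq_neg_add]
    · simp only [DihedralGroup.sr_mul_r]
      rw [mul_assoc, ← _root_.zpow_add, mul_right_inj, key]
      simp
    · simp only [DihedralGroup.sr_mul_sr]
      rw [mul_assoc, ← mul_assoc (S ^ _), hcomm, mul_assoc, ← mul_assoc, hT, one_mul,
        ← _root_.zpow_add, key]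
      simp [sub_eq_neg_add])
  have hfr (i : ZMod n) : f (.r i) = S ^ (i.cast : ℤ) := rfl
  have hfsr (i : ZMod n) : f (.sr i) = T * S ^ (i.cast : ℤ) := rfl
  have hinj : Function.Injective f := by
    rw [injective_iff_map_eq_one]
    rintro (i | i) h
    · rw [hfr, ← zpow_zero S, key] at h
      rw [DihedralGroup.one_def, DihedralGroup.r.injEq]
      simpa using h
    · exfalso
      rw [hfsr, mul_eq_one_iff_eq_inv, ← _root_.zpow_neg] at h
      have hS2 : S ^ 2 = 1 := by
        have h1 := hconj
        rw [h, ((Commute.refl S).zpow_left _).eq, mul_inv_cancel_right] at h1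
        rw [pow_two]
        nth_rewrite 1 [h1]
        exact inv_mul_cancel S
      have := Nat.le_of_dvd two_pos (orderOf_dvd_of_pow_eq_one hS2)
      omega
  have hrange : Subgroup.closure {S, T} = f.range := by
    apply le_antisymm
    · rw [Subgroup.closure_le]
      rintro x (rfl | rfl)
      · refine ⟨.r 1, ?_⟩
        rw [hfr]
        conv_rhs => rw [← zpow_one x]
        rw [key]
        simp
      · refine ⟨.sr 0, ?_⟩
        rw [hfsr, mul_eq_left, ← zpow_zero S, key]
        simp
    · have hSm : S ∈ Subgroup.closure {S, T} := Subgroup.subset_closure (by simp)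
      have hTm : T ∈ Subgroup.closure {S, T} := Subgroup.subset_closure (by simp)
      rintro _ ⟨i | i, rfl⟩
      · exact Subgroup.zpow_mem _ hSm _
      · exact Subgroup.mul_mem _ hTm (Subgroup.zpow_mem _ hSm _)
  rw [hrange]
  exact ⟨(MonoidHom.ofInjective hinj).symm⟩

/-- In the orthogonal complement of an anisotropic vector of a nondegenerate ternary form there
is an anisotropic vector. -/
theorem exists_anisotropic_orthogonal {k : Type*} [Field k] (h2 : (2 : k) ≠ 0)
    {Q : Matrix (Fin 3) (Fin 3) k} (hQ : Qᵀ = Q) (hdet : Q.det ≠ 0)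
    {v : Fin 3 → k} (hv : v ⬝ᵥ Q *ᵥ v ≠ 0) :
    ∃ w, v ⬝ᵥ Q *ᵥ w = 0 ∧ w ⬝ᵥ Q *ᵥ w ≠ 0 := by
  by_contra! H
  apply hdet
  have hsymm (x y : Fin 3 → k) : x ⬝ᵥ Q *ᵥ y = y ⬝ᵥ Q *ᵥ x := by
    rw [dotProduct_mulVec, ← mulVec_transpose, hQ, dotProduct_comm]
  have hpolar (x y : Fin 3 → k) (hx : v ⬝ᵥ Q *ᵥ x = 0) (hy : v ⬝ᵥ Q *ᵥ y = 0) :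
      x ⬝ᵥ Q *ᵥ y = 0 := by
    have h := H (x + y) (by rw [mulVec_add, dotProduct_add, hx, hy, add_zero])
    rw [mulVec_add, dotProduct_add, add_dotProduct, add_dotProduct, H x hx, H y hy,
      hsymm y x] at h
    have : 2 * (x ⬝ᵥ Q *ᵥ y) = 0 := by linear_combination h
    exact (mul_eq_zero.mp this).resolve_left h2
  set c := v ⬝ᵥ Q *ᵥ v with hc
  have hproj (x : Fin 3 → k) : v ⬝ᵥ Q *ᵥ (c • x - (v ⬝ᵥ Q *ᵥ x) • v) = 0 := by
    rw [mulVec_sub, mulVec_smul, mulVec_smul, dotProduct_sub, dotProduct_smul, dotProduct_smul,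
      smul_eq_mul, smul_eq_mul, ← hc, mul_comm, sub_self]
  have hrank (x y : Fin 3 → k) :
      c * (x ⬝ᵥ Q *ᵥ y) = (v ⬝ᵥ Q *ᵥ x) * (v ⬝ᵥ Q *ᵥ y) := by
    have h := hpolar _ _ (hproj x) (hproj y)
    rw [sub_dotProduct, smul_dotProduct, smul_dotProduct, hproj, mulVec_sub, mulVec_smul,
      mulVec_smul, dotProduct_sub, dotProduct_smul, dotProduct_smul, hsymm x v] at h
    simp only [smul_eq_mul, mul_zero, sub_zero, mul_eq_zero, hv, false_or] at h
    linear_combination h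
  have hentry (i j : Fin 3) : c * Q i j =
      (v ⬝ᵥ Q *ᵥ Pi.single i 1) * (v ⬝ᵥ Q *ᵥ Pi.single j 1) := by
    rw [← hrank]
    simp
  have hcQ : (c • Q).det = 0 := by
    have : c • Q = vecMulVec (fun i => v ⬝ᵥ Q *ᵥ Pi.single i 1)
        (fun i => v ⬝ᵥ Q *ᵥ Pi.single i 1) := by
      ext i j
      rw [Matrix.smul_apply, smul_eq_mul, hentry, vecMulVec_apply]
    rw [this, det_vecMulVec]
  rw [det_smul] at hcQ
  exact (mul_eq_zero.mp hcQ).resolve_left (pow_ne_zero _ hv)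

/-- A ternary form of discriminant `1` representing `b ≠ 0` is equivalent to
`⟨b, c, bc⟩` for some `c ≠ 0`. -/
theorem exists_transpose_mul_mul_eq_diagonal {k : Type*} [Field k] (h2 : (2 : k) ≠ 0)
    {Q : Matrix (Fin 3) (Fin 3) k} (hQ : Qᵀ = Q) {d : k} (hd : d ≠ 0) (hdet : Q.det = d ^ 2)
    {v : Fin 3 → k} {b : k} (hb : b ≠ 0) (hv : v ⬝ᵥ Q *ᵥ v = b) :
    ∃ c : k, c ≠ 0 ∧ ∃ P : Matrix (Fin 3) (Fin 3) k, IsUnit P.det ∧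
      Pᵀ * Q * P = diagonal ![b, c, b * c] := by
  obtain ⟨w, hvw, hw⟩ := exists_anisotropic_orthogonal h2 hQ
    (hdet ▸ pow_ne_zero 2 hd) (hv ▸ hb : v ⬝ᵥ Q *ᵥ v ≠ 0)
  refine ⟨w ⬝ᵥ Q *ᵥ w, hw, ?_⟩
  let u : Fin 3 → k := d⁻¹ • ((Q *ᵥ v) ⨯₃ (Q *ᵥ w))
  have hsymm (x y : Fin 3 → k) : x ⬝ᵥ Q *ᵥ y = y ⬝ᵥ Q *ᵥ x := by
    rw [dotProduct_mulVec, ← mulVec_transpose, hQ, dotProduct_comm]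
  have huv : u ⬝ᵥ Q *ᵥ v = 0 := by
    rw [smul_dotProduct, dotProduct_comm, dot_self_cross, smul_zero]
  have huw : u ⬝ᵥ Q *ᵥ w = 0 := by
    rw [smul_dotProduct, dotProduct_comm, dot_cross_self, smul_zero]
  have hQu : Q *ᵥ ((Q *ᵥ v) ⨯₃ (Q *ᵥ w)) = Q.det • (v ⨯₃ w) := by
    have h01 : Q 1 0 = Q 0 1 := congrFun₂ hQ 0 1
    have h02 : Q 2 0 = Q 0 2 := congrFun₂ hQ 0 2
    have h12 : Q 2 1 = Q 1 2 := congrFun₂ hQ 1 2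
    ext i
    fin_cases i <;>
      simp [mulVec, dotProduct, Fin.sum_univ_three, cross_apply, det_fin_three, h01, h02, h12] <;> ring
  have huu : u ⬝ᵥ Q *ᵥ u = b * (w ⬝ᵥ Q *ᵥ w) := by
    rw [mulVec_smul, hQu, hdet, smul_dotProduct, dotProduct_smul, dotProduct_smul,
      cross_dot_cross, dotProduct_comm (Q *ᵥ v) v, dotProduct_comm (Q *ᵥ w) w,
      dotProduct_comm (Q *ᵥ v) w, hsymm w v, hvw, hv]
    simp only [smul_eq_mul]
    field_simp
    ring
  let P : Matrix (Fin 3) (Fin 3) k := (of ![v, w, u])ᵀ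
  have hP : Pᵀ * Q * P = diagonal ![b, w ⬝ᵥ Q *ᵥ w, b * (w ⬝ᵥ Q *ᵥ w)] := by
    have hentry (i j : Fin 3) : (Pᵀ * Q * P) i j = ![v, w, u] i ⬝ᵥ Q *ᵥ ![v, w, u] j := by
      rw [Matrix.mul_assoc]
      rfl
    ext i j
    rw [hentry]
    fin_cases i <;> fin_cases j <;>
      simp [hv, hvw, huv, huw, huu, hsymm w v, hsymm v u, hsymm w u]
  refine ⟨P, ?_, hP⟩
  rw [isUnit_iff_ne_zero]
  intro h0
  have h := congrArg det hP
  rw [det_mul, det_mul, h0, mul_zero, det_diagonal] at h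
  simp [Fin.prod_univ_three, hb, hw] at h

/-- The order of a rotation with eigenvalues `1`, `ω`, `ω⁻¹`. -/
theorem orderOf_rotation {k K : Type*} [Field k] [Field K] [Algebra k K] (h2 : (2 : k) ≠ 0)
    {n : ℕ} (hn : 3 ≤ n) {ω : K} (hω : IsPrimitiveRoot ω n) {α : k}
    (hα : algebraMap k K α = (ω + ω⁻¹) / 2) {β : k} (hβ : β = α ^ 2 - 1) :
    β ≠ 0 ∧ orderOf (!![1, 0, 0; 0, α, β; 0, 1, α] : Matrix (Fin 3) (Fin 3) k) = n := by
  have h2K : (2 : K) ≠ 0 := by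
    have := (map_ne_zero (algebraMap k K)).mpr h2
    rwa [map_ofNat] at this
  have hω0 : ω ≠ 0 := hω.ne_zero (by omega)
  have hω2 : ω ^ 2 ≠ 1 := hω.pow_ne_one_of_pos_of_lt two_ne_zero (by omega)
  obtain ⟨δ, hδ⟩ : ∃ δ : K, δ = (ω - ω⁻¹) / 2 := ⟨_, rfl⟩
  have hδ0 : δ ≠ 0 := by
    rintro rfl
    apply hω2
    field_simp at hδ
    linear_combination -hδ
  have hβK : algebraMap k K β = δ ^ 2 := by
    rw [hβ, map_sub, map_pow, hα, map_one, hδ]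
    field_simp
    ring
  have hadd : algebraMap k K α + δ = ω := by
    rw [hα, hδ]
    field_simp
    ring
  have hsub : algebraMap k K α - δ = ω⁻¹ := by
    rw [hα, hδ]
    field_simp
    ring
  refine ⟨fun h => hδ0 ?_, ?_⟩
  · rw [h, map_zero] at hβK
    exact pow_eq_zero_iff two_ne_zero |>.mp hβK.symm
  have hpow (m : ℕ) : ∃ a b : k,
      (!![1, 0, 0; 0, α, β; 0, 1, α] : Matrix (Fin 3) (Fin 3) k) ^ m =
        !![1, 0, 0; 0, a, β * b; 0, b, a] ∧
      algebraMap k K a + δ * algebraMap k K b = ω ^ m ∧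
      algebraMap k K a - δ * algebraMap k K b = (ω ^ m)⁻¹ := by
    induction m with
    | zero => exact ⟨1, 0, by simp [one_fin_three], by simp, by simp⟩
    | succ m ih =>
      obtain ⟨a, b, h, hp, hm⟩ := ih
      refine ⟨a * α + β * b, b * α + a, ?_, ?_, ?_⟩
      · rw [pow_succ, h]
        ext i j
        fin_cases i <;> fin_cases j <;> simp [mul_apply, Fin.sum_univ_three] <;> ring
      · rw [pow_succ, ← hp, ← hadd]
        simp only [map_add, map_mul, hβK]
        ring
      · rw [pow_succ, mul_inv, ← hm, ← hsub]
        simp only [map_add, map_mul, hβK]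
        ring
  rw [hω.eq_orderOf, orderOf_eq_orderOf_iff]
  intro m
  obtain ⟨a, b, h, hp, hm⟩ := hpow m
  rw [h]
  constructor
  · intro h1
    have ha : a = 1 := by simpa using congrFun₂ h1 1 1
    have hb : b = 0 := by simpa using congrFun₂ h1 2 1
    rw [← hp, ha, hb]
    simp
  · intro h1
    rw [h1] at hp hm
    rw [inv_one] at hm
    have hb : b = 0 := by
      have : (2 * δ) * algebraMap k K b = 0 := by linear_combination hp - hm
      simpa [h2K, hδ0] using this
    have ha : a = 1 := by
      apply (algebraMap k K).injective
      simpa [hb] using hp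
    rw [ha, hb, mul_zero, one_fin_three]

/-- Conjugating by a change of basis matrix `P` carries isometries of `Pᵀ Q P` to isometries
of `Q`. -/
theorem conj_mem_SO3 {k : Type} [Field k] {Q D : Matrix (Fin 3) (Fin 3) k}
    {P M : GL (Fin 3) k} (hP : (P : Matrix (Fin 3) (Fin 3) k)ᵀ * Q * P = D)
    (hM : M ∈ SO3 k D) : P * M * P⁻¹ ∈ SO3 k Q := by
  obtain ⟨hMD, hMdet⟩ := hM
  have hPP : (P : Matrix (Fin 3) (Fin 3) k) * ((P⁻¹ : GL (Fin 3) k) : Matrix (Fin 3) (Fin 3) k)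
      = 1 := P.mul_inv
  have hPPt : ((P⁻¹ : GL (Fin 3) k) : Matrix (Fin 3) (Fin 3) k)ᵀ *
      (P : Matrix (Fin 3) (Fin 3) k)ᵀ = 1 := by
    rw [← transpose_mul, hPP, transpose_one]
  constructor
  · rw [Units.val_mul, Units.val_mul, transpose_mul, transpose_mul]
    calc _ = ((P⁻¹ : GL (Fin 3) k) : Matrix (Fin 3) (Fin 3) k)ᵀ *
          ((M : Matrix (Fin 3) (Fin 3) k)ᵀ *
            ((P : Matrix (Fin 3) (Fin 3) k)ᵀ * Q * (P : Matrix (Fin 3) (Fin 3) k)) *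
            (M : Matrix (Fin 3) (Fin 3) k)) *
          ((P⁻¹ : GL (Fin 3) k) : Matrix (Fin 3) (Fin 3) k) := by noncomm_ring
      _ = (((P⁻¹ : GL (Fin 3) k) : Matrix (Fin 3) (Fin 3) k)ᵀ *
            (P : Matrix (Fin 3) (Fin 3) k)ᵀ) * Q * ((P : Matrix (Fin 3) (Fin 3) k) *
          ((P⁻¹ : GL (Fin 3) k) : Matrix (Fin 3) (Fin 3) k)) := by
        rw [hP, hMD, ← hP]
        noncomm_ring
      _ = Q := by rw [hPPt, hPP, Matrix.one_mul, Matrix.mul_one]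
  · rw [Units.val_mul, Units.val_mul, det_mul, det_mul, hMdet, mul_one, ← det_mul, hPP, det_one]

/-- Suppose `α = (ω + ω⁻¹)/2 ∈ k` for a primitive `n`-th root of unity `ω` (`n ≥ 3`) in an
algebraic closure of `k`, and set `β = α² - 1`.  If a nondegenerate ternary quadratic form
`q` of discriminant `1` represents `-β`, then `SO(q)(k)` contains a subgroup isomorphic to
the dihedral group of order `2n` (in particular an element of order `n`); explicitly, for
`q = ⟨-β,-γ,βγ⟩` the matrices `s = [[1,0,0],[0,α,β],[0,1,α]]` and `t = diag(-1,1,-1)` lie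
in `SO(q)(k)`, satisfy `sⁿ = t² = (st)² = 1`, and `s` has order `n`. -/
theorem dihedral_subgroup_of_so3
    (k : Type) [Field k] (hchar : ringChar k ≠ 2) (n : ℕ) (hn : 3 ≤ n)
    (ω : AlgebraicClosure k) (hω : IsPrimitiveRoot ω n)
    (α : k) (hα : algebraMap k (AlgebraicClosure k) α = (ω + ω⁻¹) / 2)
    (β : k) (hβ : β = α ^ 2 - 1) :
    (∀ Q : Matrix (Fin 3) (Fin 3) k, Qᵀ = Q → (∃ d : k, d ≠ 0 ∧ Q.det = d ^ 2) →
      (∃ v : Fin 3 → k, v ⬝ᵥ Q.mulVec v = -β) →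
      ∃ H : Subgroup (GL (Fin 3) k), H ≤ SO3 k Q ∧ Nonempty (H ≃* DihedralGroup n)) ∧
    (∀ γ : k, γ ≠ 0 →
      ((!![1, 0, 0; 0, α, β; 0, 1, α] : Matrix (Fin 3) (Fin 3) k)ᵀ *
          Matrix.diagonal ![-β, -γ, β * γ] * !![1, 0, 0; 0, α, β; 0, 1, α] =
        Matrix.diagonal ![-β, -γ, β * γ] ∧
        (!![1, 0, 0; 0, α, β; 0, 1, α] : Matrix (Fin 3) (Fin 3) k).det = 1) ∧
      ((!![(-1 : k), 0, 0; 0, 1, 0; 0, 0, -1] : Matrix (Fin 3) (Fin 3) k)ᵀ *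
          Matrix.diagonal ![-β, -γ, β * γ] * !![(-1 : k), 0, 0; 0, 1, 0; 0, 0, -1] =
        Matrix.diagonal ![-β, -γ, β * γ] ∧
        (!![(-1 : k), 0, 0; 0, 1, 0; 0, 0, -1] : Matrix (Fin 3) (Fin 3) k).det = 1) ∧
      (!![1, 0, 0; 0, α, β; 0, 1, α] : Matrix (Fin 3) (Fin 3) k) ^ n = 1 ∧
      (!![(-1 : k), 0, 0; 0, 1, 0; 0, 0, -1] : Matrix (Fin 3) (Fin 3) k) ^ 2 = 1 ∧
      ((!![1, 0, 0; 0, α, β; 0, 1, α] : Matrix (Fin 3) (Fin 3) k) *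
        !![(-1 : k), 0, 0; 0, 1, 0; 0, 0, -1]) ^ 2 = 1 ∧
      orderOf (!![1, 0, 0; 0, α, β; 0, 1, α] : Matrix (Fin 3) (Fin 3) k) = n) := by
  have h2 : (2 : k) ≠ 0 := Ring.two_ne_zero hchar
  obtain ⟨hβ0, hord⟩ := orderOf_rotation h2 hn hω hα hβ
  have hsD (γ : k) : (!![1, 0, 0; 0, α, β; 0, 1, α] : Matrix (Fin 3) (Fin 3) k)ᵀ *
      Matrix.diagonal ![-β, -γ, β * γ] * !![1, 0, 0; 0, α, β; 0, 1, α] =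
      Matrix.diagonal ![-β, -γ, β * γ] := by
    ext i j
    fin_cases i <;> fin_cases j <;>
      simp [mul_apply, Fin.sum_univ_three, hβ] <;> ring
  have hsdet : (!![1, 0, 0; 0, α, β; 0, 1, α] : Matrix (Fin 3) (Fin 3) k).det = 1 := by
    simp [det_fin_three, hβ]
    ring
  have htD (γ : k) : (!![(-1 : k), 0, 0; 0, 1, 0; 0, 0, -1] : Matrix (Fin 3) (Fin 3) k)ᵀ *
      Matrix.diagonal ![-β, -γ, β * γ] * !![(-1 : k), 0, 0; 0, 1, 0; 0, 0, -1] =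
      Matrix.diagonal ![-β, -γ, β * γ] := by
    ext i j
    fin_cases i <;> fin_cases j <;> simp [mul_apply, Fin.sum_univ_three]
  have htdet : (!![(-1 : k), 0, 0; 0, 1, 0; 0, 0, -1] : Matrix (Fin 3) (Fin 3) k).det = 1 := by
    simp [det_fin_three]
  have ht2 : (!![(-1 : k), 0, 0; 0, 1, 0; 0, 0, -1] : Matrix (Fin 3) (Fin 3) k) ^ 2 = 1 := by
    rw [pow_two]
    ext i j
    fin_cases i <;> fin_cases j <;> simp [mul_apply, Fin.sum_univ_three]
  have hst2 : ((!![1, 0, 0; 0, α, β; 0, 1, α] : Matrix (Fin 3) (Fin 3) k) *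
      !![(-1 : k), 0, 0; 0, 1, 0; 0, 0, -1]) ^ 2 = 1 := by
    rw [pow_two]
    ext i j
    fin_cases i <;> fin_cases j <;> simp [mul_apply, Fin.sum_univ_three, hβ] <;> ring
  refine ⟨?_, fun γ _ => ⟨⟨hsD γ, hsdet⟩, ⟨htD γ, htdet⟩, ?_, ht2, hst2, hord⟩⟩
  · rintro Q hQ ⟨d, hd, hdet⟩ ⟨v, hv⟩
    obtain ⟨c, -, P, hPdet, hP⟩ :=
      exists_transpose_mul_mul_eq_diagonal h2 hQ hd hdet (neg_ne_zero.mpr hβ0) hv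
    let p : GL (Fin 3) k := nonsingInvUnit P hPdet
    let s : GL (Fin 3) k := nonsingInvUnit !![1, 0, 0; 0, α, β; 0, 1, α]
      (by rw [hsdet]; exact isUnit_one)
    let t : GL (Fin 3) k := nonsingInvUnit !![(-1 : k), 0, 0; 0, 1, 0; 0, 0, -1]
      (by rw [htdet]; exact isUnit_one)
    have hD : diagonal ![-β, -(-c), β * (-c)] = diagonal ![-β, c, -β * c] := by
      rw [neg_neg, mul_neg, neg_mul]
    have hs : s ∈ SO3 k (diagonal ![-β, c, -β * c]) := hD ▸ ⟨hsD (-c), hsdet⟩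
    have ht : t ∈ SO3 k (diagonal ![-β, c, -β * c]) := hD ▸ ⟨htD (-c), htdet⟩
    have hsord : orderOf s = n := by rw [← orderOf_units]; exact hord
    have htt : t * t = 1 := Units.ext (by rw [← pow_two]; exact ht2)
    have hstst : s * t * (s * t) = 1 := Units.ext (by rw [← pow_two]; exact hst2)
    refine ⟨Subgroup.closure {p * s * p⁻¹, p * t * p⁻¹}, ?_,
      closure_pair_mulEquiv_dihedralGroup hn ?_ ?_ ?_⟩
    · rw [Subgroup.closure_le]
      rintro x (rfl | rfl)
      · exact conj_mem_SO3 hP hs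
      · exact conj_mem_SO3 hP ht
    · rw [← MulAut.conj_apply, MulEquiv.orderOf_eq, hsord]
    · rw [← MulAut.conj_apply, ← map_mul, htt, map_one]
    · rw [← MulAut.conj_apply, ← MulAut.conj_apply, ← map_mul, ← map_mul, hstst, map_one]
  · conv_lhs => rw [← hord]
    exact pow_orderOf_eq_one _
end

section
/- Let k be a field with char(k) ≠ 2, 3 and let q be a nondegenerate ternary quadratic form over k whose Gram matrix Q has determinant a nonzero square (discriminant 1). If SO(q)(k) contains a subgroup isomorphic to the alternating group A₄, then q is equivalent to q₀ = ⟨1,1,1⟩, i.e., there exists P ∈ GL₃(k) with Pᵀ Q P = I₃. -/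
open Matrix

/-- Generators of `A₄` and the relations between them: two commuting involutions, permuted
together with their product by an element of order three. -/
theorem alternatingGroup_four_exists_generators :
    ∃ a b c : alternatingGroup (Fin 4), a ≠ 1 ∧ a * a = 1 ∧ b * b = 1 ∧ a * b = b * a ∧
      c * a = b * c ∧ c * b = a * b * c ∧ c * c * c = 1 := by
  refine ⟨⟨Equiv.swap 0 1 * Equiv.swap 2 3, by rw [Equiv.Perm.mem_alternatingGroup]; decide⟩,
    ⟨Equiv.swap 0 2 * Equiv.swap 1 3, by rw [Equiv.Perm.mem_alternatingGroup]; decide⟩,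
    ⟨Equiv.swap 1 2 * Equiv.swap 2 3, by rw [Equiv.Perm.mem_alternatingGroup]; decide⟩, ?_⟩
  decide

/-- If matrices `A ≠ 1`, `B`, `C` satisfy the relations of `A₄`, then some nonzero vector is
fixed by `A` and negated by `B`. -/
theorem exists_fixed_negated_vector {k n : Type*} [Field k] [Fintype n] [DecidableEq n]
    (h2 : (2 : k) ≠ 0) {A B C : Matrix n n k} (hA1 : A ≠ 1) (hA : A * A = 1)
    (hB : B * B = 1) (hAB : A * B = B * A) (hCA : C * A = B * C) (hCB : C * B = A * B * C)
    (hC : C * C * C = 1) :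
    ∃ u : n → k, u ≠ 0 ∧ A *ᵥ u = u ∧ B *ᵥ u = -u := by
  have key : (1 + A) * (1 - B) ≠ 0 := by
    intro h
    have e1 : (1 + B - A * B - A) * C = 0 := by
      have hCAB : C * (A * B) = A * C := by
        rw [← mul_assoc, hCA, mul_assoc, hCB, ← mul_assoc, ← mul_assoc, ← hAB, mul_assoc A,
          hB, mul_one]
      calc (1 + B - A * B - A) * C = C + B * C - A * B * C - A * C := by noncomm_ring
        _ = C + C * A - C * B - C * (A * B) := by rw [hCA, hCB, hCAB]
        _ = C * ((1 + A) * (1 - B)) := by noncomm_ring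
        _ = 0 := by rw [h, mul_zero]
    have e2 : 1 + B - A * B - A = 0 := by
      calc 1 + B - A * B - A = (1 + B - A * B - A) * (C * C * C) := by rw [hC, mul_one]
        _ = ((1 + B - A * B - A) * C) * C * C := by noncomm_ring
        _ = 0 := by rw [e1, zero_mul, zero_mul]
    have e3 : (2 : k) • (1 - A * B) = 0 := by
      calc (2 : k) • (1 - A * B) = (1 + A) * (1 - B) + (1 + B - A * B - A) := by
            rw [two_smul]; noncomm_ring
        _ = 0 := by rw [h, e2, add_zero]
    have e4 : A * B = 1 := by
      rcases smul_eq_zero.1 e3 with h' | h'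
      · exact absurd h' h2
      · exact (sub_eq_zero.1 h').symm
    have hB1 : B = 1 := by
      rw [e4, one_mul] at hCB
      have : C * C * (C * B) = 1 := by rw [hCB, hC]
      rwa [← mul_assoc, hC, one_mul] at this
    exact hA1 (by simpa [hB1] using e4)
  obtain ⟨w, hw⟩ : ∃ w, ((1 + A) * (1 - B)) *ᵥ w ≠ 0 := by
    by_contra! h
    exact key (Matrix.ext_of_mulVec_single fun i => by rw [h, zero_mulVec])
  refine ⟨_, hw, ?_, ?_⟩
  · rw [mulVec_mulVec]
    congr 1
    calc A * ((1 + A) * (1 - B)) = (A + A * A) * (1 - B) := by noncomm_ring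
      _ = _ := by rw [hA, add_comm]
  · rw [mulVec_mulVec, ← neg_mulVec]
    congr 1
    calc B * ((1 + A) * (1 - B)) = B - B * B + (B * A - B * A * B) := by noncomm_ring
      _ = B - 1 + (A * B - A) := by rw [← hAB, mul_assoc A, hB, mul_one]
      _ = _ := by noncomm_ring

/-- An isometry of a bilinear form preserves its values. -/
theorem dotProduct_mulVec_of_isometry {k n : Type*} [CommRing k] [Fintype n]
    {Q M : Matrix n n k} (hM : Mᵀ * Q * M = Q) (x y : n → k) :
    (M *ᵥ x) ⬝ᵥ (Q *ᵥ (M *ᵥ y)) = x ⬝ᵥ (Q *ᵥ y) := by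
  conv_rhs => rw [← hM]
  rw [← mulVec_mulVec, ← mulVec_mulVec, dotProduct_mulVec x, vecMul_transpose]

/-- Vectors on which an isometry acts with opposite signs are orthogonal. -/
theorem dotProduct_mulVec_eq_zero_of_isometry {k n : Type*} [Field k] [Fintype n]
    (h2 : (2 : k) ≠ 0) {Q M : Matrix n n k} (hM : Mᵀ * Q * M = Q) {x y : n → k}
    (hxy : (M *ᵥ x = x ∧ M *ᵥ y = -y) ∨ (M *ᵥ x = -x ∧ M *ᵥ y = y)) :
    x ⬝ᵥ (Q *ᵥ y) = 0 := by
  have h := dotProduct_mulVec_of_isometry hM x y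
  have h' : (2 : k) * (x ⬝ᵥ (Q *ᵥ y)) = 0 := by
    rcases hxy with ⟨hx, hy⟩ | ⟨hx, hy⟩ <;> rw [hx, hy] at h
    · rw [mulVec_neg, dotProduct_neg] at h
      linear_combination -h
    · rw [neg_dotProduct] at h
      linear_combination -h
  exact (mul_eq_zero.1 h').resolve_left h2

/-- A ternary form of square discriminant that is equivalent to `⟨l, l, l⟩` is equivalent to
`⟨1, 1, 1⟩`. -/
theorem exists_transpose_mul_mul_eq_one_of_smul {k : Type*} [Field k]
    {Q P : Matrix (Fin 3) (Fin 3) k} (hdisc : ∃ d : k, d ≠ 0 ∧ Q.det = d ^ 2)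
    (hP : P.det ≠ 0) {l : k} (h : Pᵀ * Q * P = l • (1 : Matrix (Fin 3) (Fin 3) k)) :
    ∃ R : Matrix (Fin 3) (Fin 3) k, IsUnit R.det ∧ Rᵀ * Q * R = 1 := by
  obtain ⟨d, hd, hQ⟩ := hdisc
  have hdet := congrArg det h
  rw [det_mul, det_mul, det_transpose, hQ, det_smul, det_one, Fintype.card_fin, mul_one] at hdet
  have hl : l ≠ 0 := by
    rintro rfl
    have : (d * P.det) ^ 2 = 0 := by linear_combination hdet
    exact mul_ne_zero hd hP (pow_eq_zero_iff two_ne_zero |>.1 this)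
  set m := l / (d * P.det) with hm
  have hm0 : m ≠ 0 := div_ne_zero hl (mul_ne_zero hd hP)
  have hml : m * m * l = 1 := by
    rw [hm]
    field_simp
    linear_combination -hdet
  refine ⟨m • P, ?_, ?_⟩
  · rw [det_smul]
    exact (mul_ne_zero (pow_ne_zero _ hm0) hP).isUnit
  · rw [transpose_smul, smul_mul, smul_mul, Matrix.mul_smul, h, smul_smul, smul_smul, hml, one_smul]

/-- If `char k ≠ 2, 3` and `SO(q)(k)` contains a subgroup isomorphic to the alternating
group `A₄`, where `q` is a nondegenerate ternary quadratic form of discriminant `1`, then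
`q` is equivalent to `q₀ = ⟨1,1,1⟩`. -/
theorem a4_subgroup_implies_equiv_q0
    (k : Type) [Field k] (h2 : ringChar k ≠ 2) (h3 : ringChar k ≠ 3)
    (Q : Matrix (Fin 3) (Fin 3) k) (hsymm : Qᵀ = Q)
    (hdisc : ∃ d : k, d ≠ 0 ∧ Q.det = d ^ 2)
    (H : Subgroup (GL (Fin 3) k)) (hH : H ≤ SO3 k Q)
    (hiso : Nonempty (H ≃* alternatingGroup (Fin 4))) :
    ∃ P : Matrix (Fin 3) (Fin 3) k, IsUnit P.det ∧ Pᵀ * Q * P = 1 := by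
  have two : (2 : k) ≠ 0 := Ring.two_ne_zero h2
  obtain ⟨φ⟩ := hiso
  obtain ⟨a, b, c, ha1, ha, hb, hab, hca, hcb, hc⟩ := alternatingGroup_four_exists_generators
  let f : alternatingGroup (Fin 4) →* Matrix (Fin 3) (Fin 3) k :=
    (Units.coeHom _).comp (H.subtype.comp φ.symm.toMonoidHom)
  have hf : Function.Injective f :=
    Units.val_injective.comp (Subtype.val_injective.comp φ.symm.injective)
  have hQ : ∀ g, (f g)ᵀ * Q * f g = Q := fun g => (hH (φ.symm g).2).1
  have hA1 : f a ≠ 1 := fun h => ha1 (hf (h.trans (map_one f).symm))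
  have hA := congrArg f ha
  have hB := congrArg f hb
  have hAB := congrArg f hab
  have hCA := congrArg f hca
  have hCB := congrArg f hcb
  have hC := congrArg f hc
  simp only [map_mul, map_one] at hA hB hAB hCA hCB hC
  have hQA := hQ a
  have hQB := hQ b
  have hQC := hQ c
  generalize f a = A at *
  generalize f b = B at *
  generalize f c = C at *
  obtain ⟨u, hu, hAu, hBu⟩ := exists_fixed_negated_vector two hA1 hA hB hAB hCA hCB hC
  obtain ⟨v, hv⟩ : ∃ v, v = C *ᵥ u := ⟨_, rfl⟩
  obtain ⟨w, hw⟩ : ∃ w, w = C *ᵥ v := ⟨_, rfl⟩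
  have hBA : A = A * B * B := by rw [mul_assoc, hB, mul_one]
  have hBv : B *ᵥ v = v := by rw [hv, mulVec_mulVec, ← hCA, ← mulVec_mulVec, hAu]
  have hABv : (A * B) *ᵥ v = -v := by
    rw [hv, mulVec_mulVec, ← hCB, ← mulVec_mulVec, hBu, mulVec_neg]
  have hAv : A *ᵥ v = -v := by rw [hBA, ← mulVec_mulVec, hBv, hABv]
  have hBw : B *ᵥ w = -w := by
    rw [hw, mulVec_mulVec, ← hCA, ← mulVec_mulVec, hAv, mulVec_neg]
  have hABw : (A * B) *ᵥ w = w := by rw [hw, mulVec_mulVec, ← hCB, ← mulVec_mulVec, hBv]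
  have hAw : A *ᵥ w = -w := by rw [hBA, ← mulVec_mulVec, hBw, mulVec_neg, hABw]
  have hCw : C *ᵥ w = u := by
    rw [hw, hv, mulVec_mulVec, mulVec_mulVec, hC, one_mulVec]
  have hw0 : w ≠ 0 := by
    rintro rfl
    exact hu (by rw [← hCw, mulVec_zero])
  have hv0 : v ≠ 0 := by
    rintro rfl
    exact hw0 (by rw [hw, mulVec_zero])
  have hvv : v ⬝ᵥ (Q *ᵥ v) = u ⬝ᵥ (Q *ᵥ u) := by
    rw [hv, dotProduct_mulVec_of_isometry hQC]
  have hww : w ⬝ᵥ (Q *ᵥ w) = u ⬝ᵥ (Q *ᵥ u) := by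
    rw [← hvv, hw, dotProduct_mulVec_of_isometry hQC]
  refine exists_transpose_mul_mul_eq_one_of_smul (P := (Matrix.of ![u, v, w])ᵀ)
    (l := u ⬝ᵥ (Q *ᵥ u)) hdisc ?_ ?_
  · rw [det_transpose, Ne, ← exists_vecMul_eq_zero_iff]
    rintro ⟨x, hx0, hx⟩
    have hx : x 0 • u + x 1 • v + x 2 • w = 0 := by
      rw [← hx, vecMul_eq_sum, Fin.sum_univ_three]
      rfl
    have hAx := congrArg (A *ᵥ ·) hx
    have hBx := congrArg (B *ᵥ ·) hx
    simp only [mulVec_add, mulVec_smul, hAu, hAv, hAw, hBu, hBv, hBw, mulVec_zero] at hAx hBx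
    have h0 : (2 * x 0) • u = 0 := by
      linear_combination (norm := module) hx + hAx
    have h1 : (2 * x 1) • v = 0 := by
      linear_combination (norm := module) hx + hBx
    have h0 : x 0 = 0 := by simpa [two, hu] using h0
    have h1 : x 1 = 0 := by simpa [two, hv0] using h1
    have h2 : x 2 = 0 := by simpa [h0, h1, hw0] using hx
    exact hx0 (by ext i; fin_cases i <;> simp [h0, h1, h2])
  · have entry : ∀ i j, ((Matrix.of ![u, v, w])ᵀᵀ * Q * (Matrix.of ![u, v, w])ᵀ) i j =
        ![u, v, w] i ⬝ᵥ (Q *ᵥ ![u, v, w] j) := fun i j => by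
      rw [transpose_transpose, mul_assoc]
      rfl
    ext i j
    rw [entry]
    fin_cases i <;> fin_cases j <;> simp [hvv, hww]
    · exact dotProduct_mulVec_eq_zero_of_isometry two hQA (.inl ⟨hAu, hAv⟩)
    · exact dotProduct_mulVec_eq_zero_of_isometry two hQA (.inl ⟨hAu, hAw⟩)
    · exact dotProduct_mulVec_eq_zero_of_isometry two hQA (.inr ⟨hAv, hAu⟩)
    · exact dotProduct_mulVec_eq_zero_of_isometry two hQB (.inl ⟨hBv, hBw⟩)
    · exact dotProduct_mulVec_eq_zero_of_isometry two hQA (.inr ⟨hAw, hAu⟩)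
    · exact dotProduct_mulVec_eq_zero_of_isometry two hQB (.inr ⟨hBw, hBv⟩)
end

section
/- Let k be a field with char(k) ≠ 2 and let q = ⟨−a,−b,ab⟩ with a, b ∈ k^×, with Gram matrix Q = diag(−a,−b,ab). There is a bijection between the set of subgroups of order 2 of SO(q)(k) modulo conjugation by elements of SO(q)(k), and the set D(q) ⊆ k^×/(k^×)² of square classes of nonzero elements represented by q (i.e., classes of values vᵀ Q v ≠ 0, v ∈ k³). -/
open Matrix

/-- The group of square classes `k^× / (k^×)²`. -/
abbrev SqClasses (k : Type) [Field k] :=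
  kˣ ⧸ (powMonoidHom 2 : kˣ →* kˣ).range

/-- The square class of a nonzero element of `k`. -/
def sqClass {k : Type} [Field k] (x : k) (hx : x ≠ 0) : SqClasses k :=
  QuotientGroup.mk (Units.mk0 x hx)

/-- Two subgroups `H₁, H₂` of `GL (Fin 3) k` are conjugate inside `SO(q)(k)`
if `P⁻¹ H₁ P = H₂` for some `P ∈ SO(q)(k)`. -/
def IsConjSubgroup (k : Type) [Field k] (Q : Matrix (Fin 3) (Fin 3) k)
    (H₁ H₂ : Subgroup (GL (Fin 3) k)) : Prop :=
  ∃ P ∈ SO3 k Q, ∀ x : GL (Fin 3) k, x ∈ H₂ ↔ P * x * P⁻¹ ∈ H₁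

/-- The set `D(q)` of square classes of nonzero elements represented by the quadratic form
with Gram matrix `Q`. -/
def reprClasses (k : Type) [Field k] (Q : Matrix (Fin 3) (Fin 3) k) : Set (SqClasses k) :=
  {c | ∃ v : Fin 3 → k, ∃ h : v ⬝ᵥ Q.mulVec v ≠ 0, c = sqClass (v ⬝ᵥ Q.mulVec v) h}

namespace TernaryForm

variable {k : Type} [Field k] {Q : Matrix (Fin 3) (Fin 3) k}

/-- The half-turn `u ↦ 2 B(v, u) / q(v) • v - u` about the line spanned by `v`. -/
def halfTurn (Q : Matrix (Fin 3) (Fin 3) k) (v : Fin 3 → k) : Matrix (Fin 3) (Fin 3) k :=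
  (2 / (v ⬝ᵥ Q *ᵥ v)) • vecMulVec v (Q *ᵥ v) - 1

theorem dotProduct_mulVec_comm_of_isSymm (hQ : Q.IsSymm) (u v : Fin 3 → k) :
    u ⬝ᵥ Q *ᵥ v = v ⬝ᵥ Q *ᵥ u := by
  rw [dotProduct_mulVec, ← mulVec_transpose, hQ.eq, dotProduct_comm]

theorem halfTurn_mulVec (hQ : Q.IsSymm) (u v : Fin 3 → k) :
    halfTurn Q v *ᵥ u = (2 * (v ⬝ᵥ Q *ᵥ u) / (v ⬝ᵥ Q *ᵥ v)) • v - u := by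
  rw [halfTurn, sub_mulVec, one_mulVec, smul_mulVec, vecMulVec_mulVec, dotProduct_comm (Q *ᵥ v),
    dotProduct_mulVec_comm_of_isSymm hQ u v]
  ext i
  simp
  ring

theorem halfTurn_mulVec_self (hQ : Q.IsSymm) {v : Fin 3 → k} (hv : v ⬝ᵥ Q *ᵥ v ≠ 0) :
    halfTurn Q v *ᵥ v = v := by
  rw [halfTurn_mulVec hQ, mul_div_cancel_right₀ _ hv, two_smul, add_sub_cancel_right]

theorem halfTurn_smul (v : Fin 3 → k) {c : k} (hc : c ≠ 0) :
    halfTurn Q (c • v) = halfTurn Q v := by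
  simp only [halfTurn, mulVec_smul, dotProduct_smul, smul_dotProduct, vecMulVec_smul,
    smul_vecMulVec, smul_smul, smul_eq_mul]
  congr 2
  by_cases h : v ⬝ᵥ Q *ᵥ v = 0
  · simp [h]
  · field_simp

theorem halfTurn_neg (v : Fin 3 → k) : halfTurn Q (-v) = halfTurn Q v := by
  rw [← neg_one_smul k v, halfTurn_smul v (neg_ne_zero.mpr one_ne_zero)]

theorem halfTurn_mul_self {v : Fin 3 → k} (hv : v ⬝ᵥ Q *ᵥ v ≠ 0) :
    halfTurn Q v * halfTurn Q v = 1 := by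
  simp only [halfTurn, sub_mul, mul_sub, smul_mul_assoc, mul_smul_comm, vecMulVec_mul_vecMulVec,
    dotProduct_comm (Q *ᵥ v) v, vecMulVec_smul, smul_smul, mul_one, one_mul]
  rw [div_mul_cancel₀ _ hv]
  ext i j
  simp
  ring

theorem transpose_halfTurn_mul (hQ : Q.IsSymm) (v : Fin 3 → k) :
    (halfTurn Q v)ᵀ * Q = Q * halfTurn Q v := by
  rw [halfTurn, transpose_sub, transpose_smul, transpose_vecMulVec, transpose_one, sub_mul, mul_sub,
    smul_mul_assoc, mul_smul_comm, vecMulVec_mul, mul_vecMulVec, ← mulVec_transpose, hQ.eq]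
  simp

theorem det_halfTurn {v : Fin 3 → k} (hv : v ⬝ᵥ Q *ᵥ v ≠ 0) : (halfTurn Q v).det = 1 := by
  have h : 2 / (v ⬝ᵥ Q *ᵥ v) * (v ⬝ᵥ Q *ᵥ v) = 2 := div_mul_cancel₀ _ hv
  rw [halfTurn]
  generalize 2 / (v ⬝ᵥ Q *ᵥ v) = c at *
  generalize Q *ᵥ v = w at *
  simp only [dotProduct, Fin.sum_univ_three] at h
  simp [det_fin_three, vecMulVec_apply]
  linear_combination h

theorem trace_halfTurn {v : Fin 3 → k} (hv : v ⬝ᵥ Q *ᵥ v ≠ 0) : (halfTurn Q v).trace = -1 := by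
  rw [halfTurn, trace_sub, trace_smul, trace_vecMulVec, smul_eq_mul, div_mul_cancel₀ _ hv]
  simp
  norm_num

theorem halfTurn_ne_one (h2 : (2 : k) ≠ 0) {v : Fin 3 → k} (hv : v ⬝ᵥ Q *ᵥ v ≠ 0) :
    halfTurn Q v ≠ 1 := by
  intro h
  have ht := trace_halfTurn hv
  rw [h] at ht
  simp at ht
  exact mul_ne_zero h2 h2 (by linear_combination ht)

theorem dotProduct_mulVec_isometry {P : Matrix (Fin 3) (Fin 3) k} (hP : Pᵀ * Q * P = Q)
    (u v : Fin 3 → k) : (P *ᵥ u) ⬝ᵥ Q *ᵥ (P *ᵥ v) = u ⬝ᵥ Q *ᵥ v := by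
  conv_rhs => rw [← hP]
  rw [← mulVec_mulVec, ← mulVec_mulVec, dotProduct_mulVec u, vecMul_transpose]

theorem mul_halfTurn_of_isometry {P : Matrix (Fin 3) (Fin 3) k} (hP : Pᵀ * Q * P = Q)
    (v : Fin 3 → k) : P * halfTurn Q v = halfTurn Q (P *ᵥ v) * P := by
  rw [halfTurn, halfTurn, dotProduct_mulVec_isometry hP, mul_sub, sub_mul, mul_smul_comm,
    smul_mul_assoc, mul_vecMulVec, vecMulVec_mul, ← mulVec_transpose, mulVec_mulVec, mulVec_mulVec,
    hP, mul_one, one_mul]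

/-- The half-turn about an anisotropic vector, as an element of the general linear group. -/
def halfTurnGL {v : Fin 3 → k} (hv : v ⬝ᵥ Q *ᵥ v ≠ 0) : GL (Fin 3) k :=
  ⟨halfTurn Q v, halfTurn Q v, halfTurn_mul_self hv, halfTurn_mul_self hv⟩

theorem halfTurnGL_mem (hQ : Q.IsSymm) {v : Fin 3 → k} (hv : v ⬝ᵥ Q *ᵥ v ≠ 0) :
    halfTurnGL hv ∈ SO3 k Q := by
  refine ⟨?_, det_halfTurn hv⟩
  change (halfTurn Q v)ᵀ * Q * halfTurn Q v = Q
  rw [transpose_halfTurn_mul hQ, mul_assoc, halfTurn_mul_self hv, mul_one]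

theorem exists_smul_eq_of_halfTurn_eq (h2 : (2 : k) ≠ 0) (hQ : Q.IsSymm) {v w : Fin 3 → k}
    (hw : w ⬝ᵥ Q *ᵥ w ≠ 0) (h : halfTurn Q v = halfTurn Q w) : ∃ c : k, w = c • v := by
  have hfix := halfTurn_mulVec_self hQ hw
  rw [← h, halfTurn_mulVec hQ, sub_eq_iff_eq_add, ← two_smul k w] at hfix
  refine ⟨2⁻¹ * (2 * (v ⬝ᵥ Q *ᵥ w) / (v ⬝ᵥ Q *ᵥ v)), ?_⟩
  rw [mul_smul, hfix, smul_smul, inv_mul_cancel₀ h2, one_smul]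

theorem sqClass_eq_iff {x y : k} (hx : x ≠ 0) (hy : y ≠ 0) :
    sqClass x hx = sqClass y hy ↔ ∃ c : k, y = c ^ 2 * x := by
  rw [sqClass, sqClass, QuotientGroup.eq]
  constructor
  · rintro ⟨c, hc⟩
    refine ⟨c, ?_⟩
    have := congrArg (Units.val) (eq_inv_mul_iff_mul_eq.mp hc)
    simp at this
    rw [← this, mul_comm]
  · rintro ⟨c, hc⟩
    have hc0 : c ≠ 0 := by
      rintro rfl
      exact hy (by simpa using hc)
    refine ⟨Units.mk0 c hc0, ?_⟩
    ext
    simp [hc]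

theorem sqClass_eq_of_halfTurn_eq (h2 : (2 : k) ≠ 0) (hQ : Q.IsSymm) {v w : Fin 3 → k}
    (hv : v ⬝ᵥ Q *ᵥ v ≠ 0) (hw : w ⬝ᵥ Q *ᵥ w ≠ 0) (h : halfTurn Q v = halfTurn Q w) :
    sqClass _ hv = sqClass _ hw := by
  obtain ⟨c, rfl⟩ := exists_smul_eq_of_halfTurn_eq h2 hQ hw h
  refine (sqClass_eq_iff hv hw).mpr ⟨c, ?_⟩
  simp [mulVec_smul]
  ring

/-- Two vectors with the same nonzero value are exchanged, up to sign, by a half-turn. -/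
theorem exists_halfTurn_mulVec_eq_or_eq_neg (h2 : (2 : k) ≠ 0) (hQ : Q.IsSymm) {u w : Fin 3 → k}
    (hu : u ⬝ᵥ Q *ᵥ u ≠ 0) (huw : u ⬝ᵥ Q *ᵥ u = w ⬝ᵥ Q *ᵥ w) :
    ∃ z : Fin 3 → k, z ⬝ᵥ Q *ᵥ z ≠ 0 ∧ (halfTurn Q z *ᵥ u = w ∨ halfTurn Q z *ᵥ u = -w) := by
  have hcomm := dotProduct_mulVec_comm_of_isSymm hQ w u
  by_cases h : (u + w) ⬝ᵥ Q *ᵥ (u + w) = 0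
  · have hz : (u - w) ⬝ᵥ Q *ᵥ (u - w) ≠ 0 := by
      intro h'
      simp only [mulVec_add, mulVec_sub, add_dotProduct, dotProduct_add, sub_dotProduct,
        dotProduct_sub] at h h'
      exact mul_ne_zero (mul_ne_zero h2 h2) hu (by linear_combination h + h' + 2 * huw)
    refine ⟨u - w, hz, Or.inr ?_⟩
    have e : 2 * ((u - w) ⬝ᵥ Q *ᵥ u) = (u - w) ⬝ᵥ Q *ᵥ (u - w) := by
      simp only [mulVec_sub, sub_dotProduct, dotProduct_sub]
      linear_combination huw - hcomm
    rw [halfTurn_mulVec hQ, e, div_self hz, one_smul]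
    abel
  · refine ⟨u + w, h, Or.inl ?_⟩
    have e : 2 * ((u + w) ⬝ᵥ Q *ᵥ u) = (u + w) ⬝ᵥ Q *ᵥ (u + w) := by
      simp only [mulVec_add, add_dotProduct, dotProduct_add]
      linear_combination huw + hcomm
    rw [halfTurn_mulVec hQ, e, div_self h, one_smul]
    abel

theorem adjugate_eq_sq_sub_trace_smul (A : Matrix (Fin 3) (Fin 3) k) :
    A.adjugate = A * A - A.trace • A + A.adjugate.trace • 1 := by
  rw [adjugate_fin_three]
  ext i j
  fin_cases i <;> fin_cases j <;>
    simp [trace_fin_three, mul_apply, Fin.sum_univ_three] <;> ring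

theorem trace_adjugate_one_add (A : Matrix (Fin 3) (Fin 3) k) :
    (1 + A).adjugate.trace = 3 + 2 * A.trace + A.adjugate.trace := by
  rw [adjugate_fin_three, adjugate_fin_three]
  simp [trace_fin_three]
  ring

theorem adjugate_eq_self_of_involution {M : Matrix (Fin 3) (Fin 3) k} (hdet : M.det = 1)
    (hsq : M * M = 1) : M.adjugate = M := by
  have h := mul_adjugate M
  rw [hdet, one_smul] at h
  rw [← one_mul M.adjugate, ← hsq, mul_assoc, h, mul_one]

theorem one_add_mul_self_of_involution {M : Matrix (Fin 3) (Fin 3) k} (hsq : M * M = 1) :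
    (1 + M) * (1 + M) = (2 : k) • (1 + M) := by
  rw [mul_add, add_mul, add_mul, hsq, two_smul]
  simp only [mul_one, one_mul]
  abel

theorem trace_eq_neg_one_of_involution {M : Matrix (Fin 3) (Fin 3) k} (hdet : M.det = 1)
    (hsq : M * M = 1) (hne : M ≠ 1) : M.trace = -1 := by
  have hadj := adjugate_eq_self_of_involution hdet hsq
  have h := adjugate_eq_sq_sub_trace_smul M
  rw [hadj, hsq] at h
  by_contra ht
  have ht' : 1 + M.trace ≠ 0 := fun h0 => ht (by linear_combination h0)
  refine hne (smul_right_injective _ ht' ?_)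
  change (1 + M.trace) • M = (1 + M.trace) • 1
  rw [add_smul, add_smul, one_smul, one_smul]
  nth_rewrite 1 [h]
  abel

theorem adjugate_one_add_of_involution {M : Matrix (Fin 3) (Fin 3) k} (hdet : M.det = 1)
    (hsq : M * M = 1) (hne : M ≠ 1) : (1 + M).adjugate = 0 := by
  have ht := trace_eq_neg_one_of_involution hdet hsq hne
  have hadj := adjugate_eq_self_of_involution hdet hsq
  rw [adjugate_eq_sq_sub_trace_smul, trace_adjugate_one_add, hadj, trace_add, ht, trace_one,
    one_add_mul_self_of_involution hsq]
  ext i j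
  simp
  ring

/-- A nonzero symmetric matrix with vanishing adjugate is determined by one of its columns. -/
theorem exists_diag_ne_zero_of_adjugate_eq_zero {S : Matrix (Fin 3) (Fin 3) k} (hS : S.IsSymm)
    (hadj : S.adjugate = 0) (hne : S ≠ 0) :
    ∃ i, S i i ≠ 0 ∧ ∀ j l, S i i * S j l = S j i * S l i := by
  have h10 : S 1 0 = S 0 1 := hS.apply 0 1
  have h20 : S 2 0 = S 0 2 := hS.apply 0 2
  have h21 : S 2 1 = S 1 2 := hS.apply 1 2
  rw [adjugate_fin_three] at hadj
  have e := fun i j => congrFun (congrFun hadj i) j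
  have e00 := e 0 0
  have e01 := e 0 1
  have e02 := e 0 2
  have e11 := e 1 1
  have e12 := e 1 2
  have e22 := e 2 2
  simp [h10, h20, h21] at e00 e01 e02 e11 e12 e22
  have hminor : ∀ i j l, S i i * S j l = S j i * S l i := by
    intro i j l
    fin_cases i <;> fin_cases j <;> fin_cases l <;> simp [h10, h20, h21] <;> grind
  by_contra! hcon
  have hdiag : ∀ i, S i i = 0 := by
    intro i
    by_contra hi
    obtain ⟨j, l, hjl⟩ := hcon i hi
    exact hjl (hminor i j l)
  refine hne ?_
  ext i j
  have := hminor j i i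
  rw [hdiag, zero_mul] at this
  simpa using this.symm

theorem exists_eq_halfTurn_of_involution (h2 : (2 : k) ≠ 0) (hQ : Q.IsSymm) (hQdet : Q.det ≠ 0)
    {M : Matrix (Fin 3) (Fin 3) k} (hM : Mᵀ * Q * M = Q) (hdet : M.det = 1)
    (hsq : M * M = 1) (hne : M ≠ 1) :
    ∃ v : Fin 3 → k, v ⬝ᵥ Q *ᵥ v ≠ 0 ∧ M = halfTurn Q v := by
  have hsa : Mᵀ * Q = Q * M := by
    rw [← mul_one (Mᵀ * Q), ← hsq, ← mul_assoc, hM]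
  set S := Q * (1 + M) with hSdef
  have hS : S.IsSymm := by
    rw [IsSymm, hSdef, transpose_mul, transpose_add, transpose_one, hQ.eq, add_mul, mul_add, hsa,
      one_mul, mul_one]
  have hadj : S.adjugate = 0 := by
    rw [hSdef, adjugate_mul_distrib, adjugate_one_add_of_involution hdet hsq hne, zero_mul]
  have hcancel : ∀ A B : Matrix (Fin 3) (Fin 3) k, Q * A = Q * B → A = B := fun A B h =>
    ((isUnit_iff_isUnit_det Q).mpr hQdet.isUnit).mul_left_cancel h
  have hS0 : S ≠ 0 := by
    intro h0
    have h1 : 1 + M = 0 := hcancel _ _ (by rw [← hSdef, h0, mul_zero])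
    have h3 := congrArg Matrix.trace h1
    rw [trace_add, trace_eq_neg_one_of_involution hdet hsq hne] at h3
    simp at h3
    exact h2 (by linear_combination h3)
  obtain ⟨i, hi, hrank⟩ := exists_diag_ne_zero_of_adjugate_eq_zero hS hadj hS0
  set v := (1 + M) *ᵥ Pi.single i 1 with hv
  have hQv : Q *ᵥ v = S.col i := by
    rw [hv, mulVec_mulVec, mulVec_single_one]
  have hNv : (1 + M) *ᵥ v = (2 : k) • v := by
    rw [hv, mulVec_mulVec, ← smul_mulVec, one_add_mul_self_of_involution hsq]
  have hq : v ⬝ᵥ Q *ᵥ v = 2 * S i i := by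
    have h : Q *ᵥ ((1 + M) *ᵥ v) = (2 : k) • S.col i := by rw [hNv, mulVec_smul, hQv]
    rw [mulVec_mulVec, ← hSdef] at h
    have h' := congrFun h i
    rw [mulVec, dotProduct_comm] at h'
    have hrow : S i = Q *ᵥ v := by
      rw [hQv]
      ext j
      exact hS.apply j i
    rw [hrow] at h'
    simpa using h'
  have hq0 : v ⬝ᵥ Q *ᵥ v ≠ 0 := hq ▸ mul_ne_zero h2 hi
  refine ⟨v, hq0, ?_⟩
  rw [halfTurn, eq_sub_iff_add_eq, add_comm]
  apply hcancel
  rw [← hSdef, mul_smul_comm, mul_vecMulVec, hq, hQv]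
  ext j l
  simp [vecMulVec_apply]
  field_simp
  linear_combination hrank j l

/-- `v` spans an axis of `H` when `H` consists of the identity and the half-turn about `v`. -/
def IsAxis (Q : Matrix (Fin 3) (Fin 3) k) (H : Subgroup (GL (Fin 3) k)) (v : Fin 3 → k) : Prop :=
  ∀ x : GL (Fin 3) k, x ∈ H ↔ x = 1 ∨ (x : Matrix (Fin 3) (Fin 3) k) = halfTurn Q v

theorem exists_isAxis (h2 : (2 : k) ≠ 0) (hQ : Q.IsSymm) (hQdet : Q.det ≠ 0)
    {H : Subgroup (GL (Fin 3) k)} (hH : H ≤ SO3 k Q) (hcard : Nat.card H = 2) :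
    ∃ v : Fin 3 → k, v ⬝ᵥ Q *ᵥ v ≠ 0 ∧ IsAxis Q H v := by
  obtain ⟨y, hy, huniq⟩ := (Nat.card_eq_two_iff' (1 : H)).mp hcard
  have hsq : (y : GL (Fin 3) k) * y = 1 := by
    have h := pow_card_eq_one' (x := y)
    rw [hcard, pow_two] at h
    simpa using congrArg Subtype.val h
  obtain ⟨v, hv, hyv⟩ := exists_eq_halfTurn_of_involution h2 hQ hQdet (hH y.2).1 (hH y.2).2
    (by simpa using congrArg Units.val hsq) (fun h => hy (Subtype.ext (Units.ext h)))
  refine ⟨v, hv, fun x => ⟨fun hx => ?_, ?_⟩⟩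
  · by_cases hx1 : x = 1
    · exact Or.inl hx1
    · have h := huniq ⟨x, hx⟩ (fun h => hx1 (congrArg Subtype.val h))
      right
      rw [← hyv, ← h]
  · rintro (rfl | h)
    · exact H.one_mem
    · rw [Units.ext (h.trans hyv.symm)]
      exact y.2

theorem IsAxis.halfTurnGL_mem {H : Subgroup (GL (Fin 3) k)} {v : Fin 3 → k} (h : IsAxis Q H v)
    (hv : v ⬝ᵥ Q *ᵥ v ≠ 0) : halfTurnGL hv ∈ H :=
  (h _).mpr (Or.inr rfl)

theorem IsAxis.halfTurn_eq (h2 : (2 : k) ≠ 0) {H : Subgroup (GL (Fin 3) k)} {v w : Fin 3 → k}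
    (h : IsAxis Q H v) (hw : w ⬝ᵥ Q *ᵥ w ≠ 0) (hmem : halfTurnGL hw ∈ H) :
    halfTurn Q w = halfTurn Q v :=
  ((h _).mp hmem).resolve_left fun h1 => halfTurn_ne_one h2 hw (congrArg Units.val h1)

theorem card_zpowers_halfTurnGL (h2 : (2 : k) ≠ 0) {v : Fin 3 → k} (hv : v ⬝ᵥ Q *ᵥ v ≠ 0) :
    Nat.card (Subgroup.zpowers (halfTurnGL hv)) = 2 := by
  rw [Nat.card_zpowers]
  refine orderOf_eq_prime ?_ fun h => halfTurn_ne_one h2 hv (congrArg Units.val h)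
  rw [pow_two]
  exact Units.ext (halfTurn_mul_self hv)

theorem sqClass_eq_iff_isConjSubgroup (h2 : (2 : k) ≠ 0) (hQ : Q.IsSymm)
    {H₁ H₂ : Subgroup (GL (Fin 3) k)} {v w : Fin 3 → k} (hv : v ⬝ᵥ Q *ᵥ v ≠ 0)
    (hw : w ⬝ᵥ Q *ᵥ w ≠ 0) (h₁ : IsAxis Q H₁ v) (h₂ : IsAxis Q H₂ w) :
    sqClass _ hv = sqClass _ hw ↔ IsConjSubgroup k Q H₁ H₂ := by
  constructor
  · intro h
    obtain ⟨c, hc⟩ := (sqClass_eq_iff hv hw).mp h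
    have hc0 : c ≠ 0 := by
      rintro rfl
      exact hw (by simpa using hc)
    have hcv : (c • v) ⬝ᵥ Q *ᵥ (c • v) = w ⬝ᵥ Q *ᵥ w := by
      rw [hc]
      simp [mulVec_smul]
      ring
    obtain ⟨z, hz, hzw⟩ := exists_halfTurn_mulVec_eq_or_eq_neg h2 hQ hw hcv.symm
    have haxis : halfTurn Q (halfTurn Q z *ᵥ w) = halfTurn Q v := by
      rcases hzw with h | h
      · rw [h, halfTurn_smul v hc0]
      · rw [h, halfTurn_neg, halfTurn_smul v hc0]
    have hmem := TernaryForm.halfTurnGL_mem hQ hz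
    have hconj : halfTurn Q z * halfTurn Q w = halfTurn Q v * halfTurn Q z := by
      rw [← haxis]
      exact mul_halfTurn_of_isometry hmem.1 w
    have hGL : halfTurnGL hz * halfTurnGL hw = halfTurnGL hv * halfTurnGL hz := Units.ext hconj
    refine ⟨halfTurnGL hz, hmem, fun x => ?_⟩
    have e₁ : (x : Matrix (Fin 3) (Fin 3) k) = halfTurn Q w ↔ x = halfTurnGL hw :=
      ⟨fun h => Units.ext h, congrArg Units.val⟩
    have e₂ : ((halfTurnGL hz * x * (halfTurnGL hz)⁻¹ : GL (Fin 3) k) :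
        Matrix (Fin 3) (Fin 3) k) = halfTurn Q v ↔
        halfTurnGL hz * x * (halfTurnGL hz)⁻¹ = halfTurnGL hv :=
      ⟨fun h => Units.ext h, congrArg Units.val⟩
    rw [h₁, h₂, e₁, e₂, mul_inv_eq_iff_eq_mul, mul_inv_eq_iff_eq_mul, ← hGL, one_mul,
      mul_right_inj, mul_eq_left]
  · rintro ⟨P, hP, hconj⟩
    have hPw : (P.val *ᵥ w) ⬝ᵥ Q *ᵥ (P.val *ᵥ w) = w ⬝ᵥ Q *ᵥ w :=
      dotProduct_mulVec_isometry hP.1 w w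
    have hPw0 : (P.val *ᵥ w) ⬝ᵥ Q *ᵥ (P.val *ᵥ w) ≠ 0 := hPw ▸ hw
    have hmem : halfTurnGL hPw0 ∈ H₁ := by
      have h := (hconj _).mp (h₂.halfTurnGL_mem hw)
      have hGL : P * halfTurnGL hw = halfTurnGL hPw0 * P :=
        Units.ext (mul_halfTurn_of_isometry hP.1 w)
      rwa [hGL, mul_inv_cancel_right] at h
    rw [← sqClass_eq_of_halfTurn_eq h2 hQ hPw0 hv (h₁.halfTurn_eq h2 hPw0 hmem)]
    simp only [hPw]

end TernaryForm

/-- For `q = ⟨-a,-b,ab⟩`, the subgroups of order `2` of `SO(q)(k)`, modulo conjugation by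
elements of `SO(q)(k)`, are in bijection with the set `D(q)` of nonzero square classes
represented by `q`. -/
theorem order_two_conjugacy_classes
    (k : Type) [Field k] (hchar : ringChar k ≠ 2)
    (a b : k) (ha : a ≠ 0) (hb : b ≠ 0) :
    ∃ f : {H : Subgroup (GL (Fin 3) k) //
            H ≤ SO3 k (Matrix.diagonal ![-a, -b, a * b]) ∧ Nat.card H = 2} →
          reprClasses k (Matrix.diagonal ![-a, -b, a * b]),
      Function.Surjective f ∧
      ∀ H₁ H₂, f H₁ = f H₂ ↔
        IsConjSubgroup k (Matrix.diagonal ![-a, -b, a * b]) H₁.1 H₂.1 := by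
  have h2 : (2 : k) ≠ 0 := Ring.two_ne_zero hchar
  set Q : Matrix (Fin 3) (Fin 3) k := Matrix.diagonal ![-a, -b, a * b] with hQdef
  have hQ : Q.IsSymm := Matrix.isSymm_diagonal _
  have hQdet : Q.det ≠ 0 := by
    rw [hQdef, det_diagonal, Fin.prod_univ_three]
    simp [ha, hb]
  choose axis haxis0 haxis using fun
    H : {H : Subgroup (GL (Fin 3) k) // H ≤ SO3 k Q ∧ Nat.card H = 2} =>
      TernaryForm.exists_isAxis h2 hQ hQdet H.2.1 H.2.2
  refine ⟨fun H => ⟨sqClass _ (haxis0 H), axis H, haxis0 H, rfl⟩, ?_, fun H₁ H₂ => ?_⟩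
  · rintro ⟨_, v, hv, rfl⟩
    refine ⟨⟨Subgroup.zpowers (TernaryForm.halfTurnGL hv),
      Subgroup.zpowers_le.mpr (TernaryForm.halfTurnGL_mem hQ hv),
      TernaryForm.card_zpowers_halfTurnGL h2 hv⟩, Subtype.ext ?_⟩
    exact (TernaryForm.sqClass_eq_of_halfTurn_eq h2 hQ hv (haxis0 _)
      ((haxis _).halfTurn_eq h2 hv (Subgroup.mem_zpowers _))).symm
  · exact Subtype.ext_iff.trans <| TernaryForm.sqClass_eq_iff_isConjSubgroup h2 hQ (haxis0 H₁)
      (haxis0 H₂) (haxis H₁) (haxis H₂)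
end

section
/- Let k be a field with char(k) ≠ 2, let n ≥ 3 with char(k) not dividing n, and let q be a nondegenerate ternary quadratic form over k of discriminant 1. If M and N are elements of SO(q)(k), each of multiplicative order n, then the cyclic subgroups ⟨M⟩ and ⟨N⟩ are conjugate in SO(q)(k): there exists P ∈ SO(q)(k) with P⁻¹⟨M⟩P = ⟨N⟩. -/
open Matrix

namespace SO3

section Matrices

variable {k : Type*} [Field k]

/-- The skew-symmetric matrix of the cross product with `v`. -/
def crossMatrix (v : Fin 3 → k) : Matrix (Fin 3) (Fin 3) k :=
  !![0, -v 2, v 1; v 2, 0, -v 0; -v 1, v 0, 0]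

/-- The half-turn with axis spanned by `u`, with respect to the form with Gram matrix `Q`. -/
def halfTurn (Q : Matrix (Fin 3) (Fin 3) k) (u : Fin 3 → k) : Matrix (Fin 3) (Fin 3) k :=
  (2 / (u ⬝ᵥ Q *ᵥ u)) • (vecMulVec u (Q *ᵥ u)) - 1

theorem crossMatrix_neg (v : Fin 3 → k) : crossMatrix (-v) = -crossMatrix v := by
  ext i j
  fin_cases i <;> fin_cases j <;> simp [crossMatrix]

theorem transpose_mul_crossMatrix_mul (g : Matrix (Fin 3) (Fin 3) k) (v : Fin 3 → k) :
    gᵀ * crossMatrix (g *ᵥ v) * g = g.det • crossMatrix v := by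
  ext i j
  fin_cases i <;> fin_cases j <;>
    simp [crossMatrix, Matrix.mul_apply, Fin.sum_univ_three, det_fin_three, mulVec, dotProduct] <;>
    ring

theorem exists_crossMatrix_eq {S : Matrix (Fin 3) (Fin 3) k} (h2 : (2 : k) ≠ 0) (hS : Sᵀ = -S) :
    ∃ v, crossMatrix v = S := by
  have h (i j : Fin 3) : S j i = -S i j := congrFun (congrFun hS i) j
  have hd (i : Fin 3) : S i i = 0 := by
    have := h i i
    have h' : 2 * S i i = 0 := by linear_combination this
    simpa [h2] using h'
  refine ⟨![S 2 1, S 0 2, S 1 0], ?_⟩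
  ext i j
  fin_cases i <;> fin_cases j <;> simp [crossMatrix, hd]
  · exact (h 1 0).symm
  · exact (h 2 1).symm
  · exact (h 0 2).symm

theorem two_mul_quadratic_eq {Q A : Matrix (Fin 3) (Fin 3) k} (hQ : Qᵀ = Q) (hdet : Q.det ≠ 0)
    {v : Fin 3 → k} (hA : Q * A = crossMatrix v) :
    2 * (v ⬝ᵥ Q *ᵥ v) = -Q.det * (A * A).trace := by
  have hadj : Q.adjugate * crossMatrix v = Q.det • A := by
    rw [← hA, ← mul_assoc, adjugate_mul, smul_mul_assoc, one_mul]
  have key : (Q.adjugate * crossMatrix v * (Q.adjugate * crossMatrix v)).trace =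
      -2 * Q.det * (v ⬝ᵥ Q *ᵥ v) := by
    have h (i j : Fin 3) : Q j i = Q i j := congrFun (congrFun hQ i) j
    simp only [trace_fin_three, Matrix.mul_apply, Fin.sum_univ_three, adjugate_fin_three,
      crossMatrix,
      det_fin_three, mulVec, dotProduct, h 0 1, h 0 2, h 1 2, of_apply, cons_val', cons_val_zero,
      cons_val_one, cons_val]
    ring
  rw [hadj, smul_mul_assoc, mul_smul_comm, trace_smul, trace_smul, smul_eq_mul, smul_eq_mul] at key
  apply mul_left_cancel₀ hdet
  linear_combination key

theorem halfTurn_mulVec (Q : Matrix (Fin 3) (Fin 3) k) (u x : Fin 3 → k) :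
    halfTurn Q u *ᵥ x = (2 * ((Q *ᵥ u) ⬝ᵥ x) / (u ⬝ᵥ Q *ᵥ u)) • u - x := by
  rw [halfTurn, sub_mulVec, smul_mulVec, vecMulVec_mulVec, one_mulVec]
  ext i
  simp
  ring

theorem halfTurn_mul_self {Q : Matrix (Fin 3) (Fin 3) k} {u : Fin 3 → k} (hu : u ⬝ᵥ Q *ᵥ u ≠ 0) :
    halfTurn Q u * halfTurn Q u = 1 := by
  have h : vecMulVec u (Q *ᵥ u) * vecMulVec u (Q *ᵥ u) =
      (u ⬝ᵥ Q *ᵥ u) • vecMulVec u (Q *ᵥ u) := by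
    rw [vecMulVec_mul_vecMulVec, dotProduct_comm, vecMulVec_smul]
  rw [halfTurn, sub_mul, mul_sub, one_mul, mul_one, smul_mul_assoc, mul_smul_comm, h,
    smul_smul, smul_smul, mul_assoc,
    div_mul_cancel₀ _ hu]
  module

theorem halfTurn_transpose_mul {Q : Matrix (Fin 3) (Fin 3) k} (hQ : Qᵀ = Q) (u : Fin 3 → k) :
    (halfTurn Q u)ᵀ * Q = Q * halfTurn Q u := by
  rw [halfTurn, transpose_sub, transpose_smul, transpose_vecMulVec, transpose_one, sub_mul, mul_sub,
    smul_mul_assoc, mul_smul_comm, vecMulVec_mul, mul_vecMulVec, ← mulVec_transpose, hQ, one_mul,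
    mul_one]

theorem det_halfTurn {Q : Matrix (Fin 3) (Fin 3) k} {u : Fin 3 → k} (hu : u ⬝ᵥ Q *ᵥ u ≠ 0) :
    (halfTurn Q u).det = 1 := by
  have h : (halfTurn Q u).det = 2 / (u ⬝ᵥ Q *ᵥ u) * (u ⬝ᵥ Q *ᵥ u) - 1 := by
    unfold halfTurn
    generalize Q *ᵥ u = w
    generalize 2 / (u ⬝ᵥ w) = c
    simp [det_fin_three, vecMulVec_apply, dotProduct, Fin.sum_univ_three]
    ring
  rw [h, div_mul_cancel₀ _ hu]
  norm_num

theorem trace_mul_self_fin_three (M : Matrix (Fin 3) (Fin 3) k) :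
    (M * M).trace = M.trace ^ 2 - 2 * M.adjugate.trace := by
  simp only [trace_fin_three, Matrix.mul_apply, Fin.sum_univ_three, adjugate_fin_three, of_apply,
    cons_val', cons_val_zero, cons_val_one, cons_val]
  ring

theorem cayley_hamilton_fin_three (M : Matrix (Fin 3) (Fin 3) k) :
    M * M * M - M.trace • (M * M) + M.adjugate.trace • M - M.det • 1 = 0 := by
  ext i j
  fin_cases i <;> fin_cases j <;>
  · simp [trace_fin_three, Matrix.mul_apply, Fin.sum_univ_three, adjugate_fin_three, det_fin_three]
    ring

/-- The identities satisfied by an isometry `M` of determinant one and its inverse `M'`. -/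
structure IsRot (Q M M' : Matrix (Fin 3) (Fin 3) k) : Prop where
  transpose_mul : Mᵀ * Q = Q * M'
  mul_inv : M * M' = 1
  inv_mul : M' * M = 1
  trace_inv : M'.trace = M.trace
  adjugate_eq : M.adjugate = M'
  det_eq : M.det = 1

theorem isRot_of_mem {Q M : Matrix (Fin 3) (Fin 3) k} (hdet : Q.det ≠ 0)
    (hM : Mᵀ * Q * M = Q) (hM1 : M.det = 1) : IsRot Q M M.adjugate := by
  have h1 : M * M.adjugate = 1 := by rw [mul_adjugate, hM1, one_smul]
  have h2 : M.adjugate * M = 1 := by rw [adjugate_mul, hM1, one_smul]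
  have h3 : Mᵀ * Q = Q * M.adjugate := by
    calc Mᵀ * Q = Mᵀ * Q * M * M.adjugate := by rw [mul_assoc _ M, h1, mul_one]
      _ = _ := by rw [hM]
  refine ⟨h3, h1, h2, ?_, rfl, hM1⟩
  have hQ : IsUnit Q.det := hdet.isUnit
  have : M.adjugate = Q⁻¹ * Mᵀ * Q := by
    rw [mul_assoc, h3, ← mul_assoc, nonsing_inv_mul _ hQ, one_mul]
  rw [this, mul_assoc, trace_mul_comm, mul_assoc, mul_nonsing_inv _ hQ, mul_one, trace_transpose]

namespace IsRot

variable {Q M M' : Matrix (Fin 3) (Fin 3) k}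

theorem symm (h : IsRot Q M M') (hQ : Qᵀ = Q) : M'ᵀ * Q = Q * M := by
  have := congrArg transpose h.transpose_mul
  simpa [hQ] using this.symm

theorem cube_eq (h : IsRot Q M M') :
    M * M * M - M.trace • (M * M) + M.trace • M - 1 = 0 := by
  have := cayley_hamilton_fin_three M
  rwa [h.adjugate_eq, h.trace_inv, h.det_eq, one_smul] at this

theorem trace_mul_self (h : IsRot Q M M') : (M * M).trace = M.trace ^ 2 - 2 * M.trace := by
  rw [trace_mul_self_fin_three, h.adjugate_eq, h.trace_inv]

theorem trace_inv_mul_self (h : IsRot Q M M') :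
    (M' * M').trace = M.trace ^ 2 - 2 * M.trace := by
  have : M'.adjugate = M := by
    rw [← h.adjugate_eq, adjugate_adjugate _ (by simp), h.det_eq]
    simp
  rw [trace_mul_self_fin_three, this, h.trace_inv]

theorem trace_sub_inv_sq (h : IsRot Q M M') :
    ((M - M') * (M - M')).trace = 2 * (M.trace - 3) * (M.trace + 1) := by
  rw [sub_mul, mul_sub, mul_sub, h.mul_inv, h.inv_mul, trace_sub, trace_sub, trace_sub,
    h.trace_mul_self, h.trace_inv_mul_self, trace_one]
  simp
  ring

theorem smul_add_inv (h : IsRot Q M M') :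
    (M.trace + 1) • (M + M' - (2 : k) • 1) = (M - M') * (M - M') := by
  have h1 := h.cube_eq
  have e1 : M * M - M.trace • M + M.trace • 1 - M' = 0 := by
    have := congrArg (· * M') h1
    simpa [sub_mul, add_mul, mul_assoc, h.mul_inv] using this
  have e2 : M - M.trace • 1 + M.trace • M' - M' * M' = 0 := by
    have := congrArg (· * M') e1
    simpa [sub_mul, add_mul, mul_assoc, h.mul_inv] using this
  have e3 : (M - M') * (M - M') = M * M + M' * M' - (2 : k) • 1 := by
    rw [sub_mul, mul_sub, mul_sub, h.mul_inv, h.inv_mul, two_smul]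
    abel
  have e1' : M * M = M.trace • M - M.trace • 1 + M' := by
    rw [← sub_eq_zero, ← e1]; abel
  have e2' : M' * M' = M - M.trace • 1 + M.trace • M' := by
    rw [← sub_eq_zero, ← neg_eq_zero, ← e2]; abel
  rw [e3, e1', e2']
  module

theorem two_smul_smul_eq (h : IsRot Q M M') :
    (2 * (M.trace + 1)) • M = (2 * (M.trace + 1)) • 1 + (M.trace + 1) • (M - M') +
      (M - M') * (M - M') := by
  rw [← h.smul_add_inv]
  module

theorem two_smul_smul_inv_eq (h : IsRot Q M M') :
    (2 * (M.trace + 1)) • M' = (2 * (M.trace + 1)) • 1 - (M.trace + 1) • (M - M') +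
      (M - M') * (M - M') := by
  rw [← h.smul_add_inv]
  module

theorem exists_axis (h : IsRot Q M M') (h2 : (2 : k) ≠ 0) (hQ : Qᵀ = Q) :
    ∃ v, Q * (M - M') = crossMatrix v := by
  obtain ⟨v, hv⟩ := exists_crossMatrix_eq (S := Q * (M - M')) h2 (by
    rw [Matrix.transpose_mul, transpose_sub, hQ, sub_mul, h.transpose_mul, h.symm hQ, mul_sub]
    abel)
  exact ⟨v, hv.symm⟩

theorem exists_halfTurn_conj {N N' : Matrix (Fin 3) (Fin 3) k} (hM : IsRot Q M M')
    (hN : IsRot Q N N') (h2 : (2 : k) ≠ 0) (hQ : Qᵀ = Q) (hdet : Q.det ≠ 0)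
    (htr : M.trace = N.trace) (h3 : M.trace ≠ 3) (h1 : M.trace ≠ -1) :
    ∃ P : Matrix (Fin 3) (Fin 3) k, Pᵀ * Q * P = Q ∧ P.det = 1 ∧ P * P = 1 ∧
      (P * N * P = M ∨ P * N * P = M') := by
  obtain ⟨v, hv⟩ := hM.exists_axis h2 hQ
  obtain ⟨w, hw⟩ := hN.exists_axis h2 hQ
  have hqv := two_mul_quadratic_eq hQ hdet hv
  have hqw := two_mul_quadratic_eq hQ hdet hw
  rw [hM.trace_sub_inv_sq] at hqv
  rw [hN.trace_sub_inv_sq, ← htr] at hqw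
  have hvw : v ⬝ᵥ Q *ᵥ v = w ⬝ᵥ Q *ᵥ w := mul_left_cancel₀ h2 (hqv.trans hqw.symm)
  have hT1 : M.trace + 1 ≠ 0 := fun h => h1 (by linear_combination h)
  have hv0 : v ⬝ᵥ Q *ᵥ v ≠ 0 := by
    intro h
    have h3' : M.trace - 3 ≠ 0 := sub_ne_zero.2 h3
    rw [h, mul_zero, eq_comm] at hqv
    simp [hdet, h2, h3', hT1] at hqv
  have hcomm (x y : Fin 3 → k) : (Q *ᵥ x) ⬝ᵥ y = x ⬝ᵥ Q *ᵥ y := by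
    rw [dotProduct_mulVec, ← mulVec_transpose, hQ]
  have hvw' : w ⬝ᵥ Q *ᵥ v = v ⬝ᵥ Q *ᵥ w := by rw [← hcomm, dotProduct_comm]
  obtain ⟨u, hu, hPv⟩ : ∃ u : Fin 3 → k, u ⬝ᵥ Q *ᵥ u ≠ 0 ∧
      (halfTurn Q u *ᵥ v = w ∨ halfTurn Q u *ᵥ v = -w) := by
    have hp : (v + w) ⬝ᵥ Q *ᵥ (v + w) = 2 * (v ⬝ᵥ Q *ᵥ v) + 2 * (v ⬝ᵥ Q *ᵥ w) := by
      simp only [mulVec_add, add_dotProduct, dotProduct_add, hvw', ← hvw]; ring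
    have hm : (v - w) ⬝ᵥ Q *ᵥ (v - w) = 2 * (v ⬝ᵥ Q *ᵥ v) - 2 * (v ⬝ᵥ Q *ᵥ w) := by
      simp only [mulVec_sub, sub_dotProduct, dotProduct_sub, hvw', ← hvw]; ring
    by_cases hu : (v + w) ⬝ᵥ Q *ᵥ (v + w) = 0
    · have hu' : (v - w) ⬝ᵥ Q *ᵥ (v - w) ≠ 0 := by
        intro h
        have : 2 * (2 * (v ⬝ᵥ Q *ᵥ v)) = 0 := by linear_combination hu - hp + h - hm
        simp [h2, hv0] at this
      refine ⟨v - w, hu', Or.inr ?_⟩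
      have : 2 * ((Q *ᵥ (v - w)) ⬝ᵥ v) = (v - w) ⬝ᵥ Q *ᵥ (v - w) := by
        rw [hm, hcomm, sub_dotProduct, hvw']; ring
      rw [halfTurn_mulVec, this, div_self hu', one_smul]
      abel
    · refine ⟨v + w, hu, Or.inl ?_⟩
      have : 2 * ((Q *ᵥ (v + w)) ⬝ᵥ v) = (v + w) ⬝ᵥ Q *ᵥ (v + w) := by
        rw [hp, hcomm, add_dotProduct, hvw']; ring
      rw [halfTurn_mulVec, this, div_self hu, one_smul]
      abel
  have hPP := halfTurn_mul_self hu
  have hPQ := halfTurn_transpose_mul hQ u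
  have hPd := det_halfTurn hu
  have hPX := transpose_mul_crossMatrix_mul (halfTurn Q u) v
  generalize halfTurn Q u = P at *
  rw [hPd, one_smul, ← hv] at hPX
  refine ⟨P, by rw [hPQ, mul_assoc, hPP, mul_one], hPd, hPP, ?_⟩
  have hcancel {X Y : Matrix (Fin 3) (Fin 3) k} (h : Q * X = Q * Y) : X = Y :=
    ((isUnit_iff_isUnit_det Q).2 hdet.isUnit).mul_left_cancel h
  have hconj (B : Matrix (Fin 3) (Fin 3) k) : P * (B * B) * P = (P * B * P) * (P * B * P) := by
    calc P * (B * B) * P = P * B * 1 * B * P := by noncomm_ring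
      _ = P * B * (P * P) * B * P := by rw [hPP]
      _ = _ := by noncomm_ring
  have hexp : (2 * (M.trace + 1)) • (P * N * P) = (2 * (M.trace + 1)) • 1 +
      (M.trace + 1) • (P * (N - N') * P) + (P * (N - N') * P) * (P * (N - N') * P) := by
    have := hN.two_smul_smul_eq
    rw [← htr] at this
    rw [← smul_mul_assoc, ← mul_smul_comm, this, ← hconj, mul_add, mul_add, add_mul, add_mul,
      mul_smul_comm, mul_smul_comm, smul_mul_assoc, smul_mul_assoc, mul_one, hPP]
  have hc : 2 * (M.trace + 1) ≠ 0 := mul_ne_zero h2 hT1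
  rcases hPv with h | h
  · left
    have hA : P * (N - N') * P = M - M' := by
      apply hcancel
      rw [← hPX, h, ← hw, ← mul_assoc Pᵀ, hPQ]; noncomm_ring
    rw [hA, ← hM.two_smul_smul_eq] at hexp
    exact smul_right_injective _ hc hexp
  · right
    have hA : P * (N - N') * P = -(M - M') := by
      apply hcancel
      rw [mul_neg, ← hPX, h, crossMatrix_neg, ← hw, mul_neg, neg_mul, ← mul_assoc Pᵀ, hPQ,
        neg_neg]
      noncomm_ring
    rw [hA, neg_mul_neg, smul_neg, ← sub_eq_add_neg, ← hM.two_smul_smul_inv_eq] at hexp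
    exact smul_right_injective _ hc hexp

theorem trace_pow_eq {L : Type*} [Field L] [Algebra k L] (h : IsRot Q M M') {a b : L}
    (hab : a * b = 1) (ht : algebraMap k L M.trace = 1 + a + b) (j : ℕ) :
    algebraMap k L (M ^ j).trace = 1 + a ^ j + b ^ j := by
  induction j using Nat.strong_induction_on with
  | _ j ih =>
    match j with
    | 0 => norm_num [Matrix.trace_one, map_ofNat]
    | 1 => simpa using ht
    | 2 =>
      rw [pow_two M, h.trace_mul_self]
      simp only [map_sub, map_mul, map_pow, map_ofNat, ht]
      linear_combination 2 * hab
    | j + 3 =>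
      have e : M ^ (j + 3) = M.trace • M ^ (j + 2) - M.trace • M ^ (j + 1) + M ^ j := by
        have := congrArg (M ^ j * ·) h.cube_eq
        rw [← sub_eq_zero, ← mul_zero (M ^ j), ← this]
        simp only [mul_sub, mul_add, mul_smul_comm, pow_succ, mul_assoc, mul_one]
        abel
      rw [e, trace_add, trace_sub, trace_smul, trace_smul]
      simp only [map_sub, map_add, map_mul, smul_eq_mul, ih (j + 2) (by lia), ih (j + 1) (by lia),
        ih j (by lia), ht]
      linear_combination (a ^ (j + 1) + b ^ (j + 1) - a ^ j - b ^ j) * hab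

theorem aeval_eq_zero_of_pow_of_pow_eq_one {n : ℕ} (hn : (n : k) ≠ 0) (hMn : M ^ n = 1)
    {p : Polynomial k} {e : ℕ} (hp : Polynomial.aeval M (p ^ e) = 0) :
    Polynomial.aeval M p = 0 := by
  have hsq : Squarefree (minpoly k M) :=
    ((Polynomial.separable_X_pow_sub_C (1 : k) hn one_ne_zero).squarefree).squarefree_of_dvd
      (minpoly.dvd k M (by simp [hMn]))
  exact (minpoly.dvd_iff).1 (hsq.isRadical _ _ (minpoly.dvd k M hp))

theorem eq_one_of_trace {n : ℕ} (h : IsRot Q M M') (hn : (n : k) ≠ 0) (hMn : M ^ n = 1)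
    (h3 : M.trace = 3) : M = 1 := by
  have := aeval_eq_zero_of_pow_of_pow_eq_one hn hMn (p := Polynomial.X - 1) (e := 3) (by
    have := h.cube_eq
    rw [h3] at this
    simp only [map_pow, map_sub, Polynomial.aeval_X, map_one]
    rw [← this]
    simp only [← Nat.cast_ofNat (R := k), Nat.cast_smul_eq_nsmul]
    noncomm_ring)
  simpa [sub_eq_zero] using this

theorem mul_self_eq_one_of_trace {n : ℕ} (h : IsRot Q M M') (hn : (n : k) ≠ 0) (hMn : M ^ n = 1)
    (h1 : M.trace = -1) : M * M = 1 := by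
  have := aeval_eq_zero_of_pow_of_pow_eq_one hn hMn (p := Polynomial.X * Polynomial.X - 1)
    (e := 2) (by
    have := h.cube_eq
    rw [h1] at this
    have e : (M * M - 1) ^ 2 =
        (M * M * M - (-1 : k) • (M * M) + (-1 : k) • M - 1) * (M - 1) := by
      simp only [neg_smul, one_smul]
      noncomm_ring
    simp only [map_pow, map_sub, map_mul, Polynomial.aeval_X, map_one]
    rw [e, this, zero_mul])
  simpa [sub_eq_zero] using this

end IsRot

end Matrices

theorem isRot {k : Type} [Field k] {Q : Matrix (Fin 3) (Fin 3) k} (hdet : Q.det ≠ 0)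
    {M : GL (Fin 3) k} (hM : M ∈ SO3 k Q) :
    IsRot Q (M : Matrix (Fin 3) (Fin 3) k) (M : Matrix (Fin 3) (Fin 3) k).adjugate :=
  isRot_of_mem hdet hM.1 hM.2

/-- The nontrivial eigenvalues of an element of order `n` are primitive `n`-th roots of unity. -/
theorem exists_primitiveRoot_trace {k : Type} [Field k] {Q : Matrix (Fin 3) (Fin 3) k}
    (hdet : Q.det ≠ 0) {M : GL (Fin 3) k} (hM : M ∈ SO3 k Q) {n : ℕ} (hn : (n : k) ≠ 0)
    (hord : orderOf M = n) :
    ∃ a : AlgebraicClosure k, IsPrimitiveRoot a n ∧ ∀ j : ℕ,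
      algebraMap k (AlgebraicClosure k) ((M : Matrix (Fin 3) (Fin 3) k) ^ j).trace =
        1 + a ^ j + (a⁻¹) ^ j := by
  set τ := algebraMap k (AlgebraicClosure k) (M : Matrix (Fin 3) (Fin 3) k).trace with hτ
  obtain ⟨a, ha⟩ := IsAlgClosed.exists_root
    (Polynomial.X ^ 2 - Polynomial.C (τ - 1) * Polynomial.X + 1 :
      Polynomial (AlgebraicClosure k)) (by
    have : (Polynomial.X ^ 2 - Polynomial.C (τ - 1) * Polynomial.X + 1 :
      Polynomial (AlgebraicClosure k)).degree = 2 := by compute_degree!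
    rw [this]; norm_num)
  have ha' : a ^ 2 - (τ - 1) * a + 1 = 0 := by simpa using ha
  have ha0 : a ≠ 0 := by rintro rfl; simp at ha'
  have hrot := isRot hdet hM
  have htr := hrot.trace_pow_eq (L := AlgebraicClosure k) (mul_inv_cancel₀ ha0) (by
    rw [← hτ]
    field_simp
    linear_combination -ha')
  have hMn : M ^ n = 1 := by rw [← hord, pow_orderOf_eq_one]
  refine ⟨a, ⟨?_, fun d hd => ?_⟩, htr⟩
  · have h := htr n
    rw [← Units.val_pow_eq_pow_val, hMn, inv_pow] at h
    have hb : a ^ n * (a ^ n)⁻¹ = 1 := mul_inv_cancel₀ (pow_ne_zero _ ha0)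
    have h3 : (3 : AlgebraicClosure k) = 1 + a ^ n + (a ^ n)⁻¹ := by simpa [map_ofNat] using h
    have : (a ^ n - 1) ^ 2 = 0 := by linear_combination -a ^ n * h3 - hb
    exact sub_eq_zero.1 (pow_eq_zero_iff two_ne_zero |>.1 this)
  · have h := htr d
    rw [inv_pow, hd, inv_one, ← Units.val_pow_eq_pow_val] at h
    have h3 : ((M ^ d : GL (Fin 3) k) : Matrix (Fin 3) (Fin 3) k).trace = 3 := by
      apply (algebraMap k (AlgebraicClosure k)).injective
      rw [h, map_ofNat]; norm_num
    have := (isRot hdet (pow_mem hM d)).eq_one_of_trace hn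
      (by rw [← Units.val_pow_eq_pow_val, ← pow_mul, mul_comm, pow_mul, hMn, one_pow,
        Units.val_one]) h3
    rw [← hord]
    exact orderOf_dvd_of_pow_eq_one (Units.ext this)

theorem exists_pow_trace_eq {k : Type} [Field k] {Q : Matrix (Fin 3) (Fin 3) k}
    (hdet : Q.det ≠ 0) {M N : GL (Fin 3) k} (hM : M ∈ SO3 k Q) (hN : N ∈ SO3 k Q) {n : ℕ}
    (hn : (n : k) ≠ 0) (hordM : orderOf M = n) (hordN : orderOf N = n) :
    ∃ j : ℕ, j.Coprime n ∧ ((M ^ j : GL (Fin 3) k) : Matrix (Fin 3) (Fin 3) k).trace =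
      (N : Matrix (Fin 3) (Fin 3) k).trace := by
  have : NeZero n := ⟨by rintro rfl; simp at hn⟩
  obtain ⟨a, ha, hMa⟩ := exists_primitiveRoot_trace hdet hM hn hordM
  obtain ⟨b, hb, hNb⟩ := exists_primitiveRoot_trace hdet hN hn hordN
  obtain ⟨j, -, hj, rfl⟩ := ha.isPrimitiveRoot_iff.1 hb
  refine ⟨j, hj, (algebraMap k (AlgebraicClosure k)).injective ?_⟩
  have := hNb 1
  simp only [pow_one] at this
  rw [this, Units.val_pow_eq_pow_val, hMa, inv_pow]

end SO3

/-- Any two cyclic subgroups of `SO(q)(k)` generated by elements of the same multiplicative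
order `n ≥ 3` (with `char k ∤ n`, `char k ≠ 2`) are conjugate in `SO(q)(k)`, for a
nondegenerate ternary quadratic form `q` of discriminant `1`. -/
theorem cyclic_subgroups_conjugate
    (k : Type) [Field k] (hchar : ringChar k ≠ 2)
    (n : ℕ) (hn : 3 ≤ n) (hcharn : ¬ (ringChar k ∣ n))
    (Q : Matrix (Fin 3) (Fin 3) k) (hsymm : Qᵀ = Q)
    (hdisc : ∃ d : k, d ≠ 0 ∧ Q.det = d ^ 2)
    (M N : GL (Fin 3) k) (hM : M ∈ SO3 k Q) (hN : N ∈ SO3 k Q)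
    (hordM : orderOf M = n) (hordN : orderOf N = n) :
    ∃ P ∈ SO3 k Q, ∀ x : GL (Fin 3) k,
      x ∈ Subgroup.zpowers N ↔ P * x * P⁻¹ ∈ Subgroup.zpowers M := by
  obtain ⟨d, hd, hQd⟩ := hdisc
  have hdet : Q.det ≠ 0 := by rw [hQd]; exact pow_ne_zero 2 hd
  have h2 : (2 : k) ≠ 0 := Ring.two_ne_zero hchar
  have hnk : (n : k) ≠ 0 := fun h => hcharn ((ringChar.spec k n).1 h)
  obtain ⟨j, hj, htr⟩ := SO3.exists_pow_trace_eq hdet hM hN hnk hordM hordN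
  have hNrot := SO3.isRot hdet hN
  have hNn : (N : Matrix (Fin 3) (Fin 3) k) ^ n = 1 := by
    rw [← Units.val_pow_eq_pow_val, ← hordN, pow_orderOf_eq_one, Units.val_one]
  have hsmall {m : ℕ} (hm : 0 < m) (hm3 : m < 3) : N ^ m ≠ 1 := by
    intro h
    have := Nat.le_of_dvd hm (orderOf_dvd_of_pow_eq_one h)
    lia
  obtain ⟨P, hPQ, hPd, hPP, hP⟩ := (SO3.isRot hdet (pow_mem hM j)).exists_halfTurn_conj hNrot
    h2 hsymm hdet htr
    (fun h => hsmall one_pos (by norm_num) (by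
      rw [pow_one]
      exact Units.ext (hNrot.eq_one_of_trace hnk hNn (htr ▸ h))))
    (fun h => hsmall two_pos (by norm_num) (by
      rw [pow_two]
      exact Units.ext (hNrot.mul_self_eq_one_of_trace hnk hNn (htr ▸ h))))
  let P' : GL (Fin 3) k := ⟨P, P, hPP, hPP⟩
  have hconj : P' * N * P'⁻¹ = M ^ j ∨ P' * N * P'⁻¹ = (M ^ j)⁻¹ := by
    refine hP.imp (fun h => Units.ext h) (fun h => eq_inv_of_mul_eq_one_left (Units.ext ?_))
    exact (congrArg (· * _) h).trans (SO3.isRot hdet (pow_mem hM j)).inv_mul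
  have hzM : Subgroup.zpowers (M ^ j) = Subgroup.zpowers M := by
    apply le_antisymm
    · rw [Subgroup.zpowers_le]; exact Subgroup.npow_mem_zpowers M j
    · obtain ⟨m, hm⟩ := exists_pow_eq_self_of_coprime (x := M) (n := j) (by rwa [hordM])
      rw [Subgroup.zpowers_le]
      exact ⟨m, by simpa using hm⟩
  have hz : Subgroup.zpowers (P' * N * P'⁻¹) = Subgroup.zpowers M := by
    rcases hconj with h | h
    · rw [h, hzM]
    · rw [h, Subgroup.zpowers_inv, hzM]
  refine ⟨P', ⟨hPQ, hPd⟩, fun x => ?_⟩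
  rw [← hz]
  simp only [Subgroup.mem_zpowers_iff, conj_zpow, mul_left_inj, mul_right_inj]
end
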